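/- Let g be an indecomposable symmetrizable Kac-Moody algebra, finitely Σ-graded with grading subalgebra m, with adapted root basis Π_a = {γ_s, s∈Ī} of Σ and J = {i∈I : ρ_a(α_i)=0}. Then: (1) for each k∈I'_re, the component I_k is of finite type; (2) for s∈Ī, if k≠l both lie in Γ_s then I_k∪I_l is not connected, so g(I_k) and g(I_l) commute and are orthogonal; (3) for every k∈I'_re, the pair (I_k,J_k) is an irreducible C-admissible pair; (4) the derived subalgebra m' of m is contained in g'(I_re). -/

import Mathlib

attribute [local instance] Classical.propDecidable

noncomputable section

namespace KMG

open Module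

/-! ### Generalized Cartan matrices -/

/-- `A` is a generalized Cartan matrix. -/
def IsGCM {I : Type*} (A : Matrix I I ℤ) : Prop :=
  (∀ i, A i i = 2) ∧ (∀ i j, i ≠ j → A i j ≤ 0) ∧ ∀ i j, A i j = 0 → A j i = 0

/-- `A` is indecomposable. -/
def Indecomposable {I : Type*} (A : Matrix I I ℤ) : Prop :=
  ∀ s : Set I, s.Nonempty → sᶜ.Nonempty → ∃ i ∈ s, ∃ j ∈ sᶜ, A i j ≠ 0

/-- `A` is symmetrizable: `D A` is symmetric for an invertible diagonal matrix `D`. -/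
def Symmetrizable {I : Type*} (A : Matrix I I ℤ) : Prop :=
  ∃ d : I → ℚ, (∀ i, d i ≠ 0) ∧ ∀ i j, d i * (A i j : ℚ) = d j * (A j i : ℚ)

/-- The principal submatrix of `A` indexed by a subset `S`. -/
def restrictM {I : Type*} (A : Matrix I I ℤ) (S : Set I) : Matrix S S ℤ :=
  fun i j => A i.1 j.1

/-- `A` is of finite type: `A u > 0` for some `u > 0` (Kac, Thm. 4.3). -/
def IsFiniteType {I : Type*} (A : Matrix I I ℤ) : Prop :=
  ∃ u : I → ℚ, (∀ i, 0 < u i) ∧ ∀ i, 0 < ∑ᶠ j, (A i j : ℚ) * u j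

/-- `A` is of affine type: `A` indecomposable and `A u = 0` for some `u > 0`. -/
def IsAffineType {I : Type*} (A : Matrix I I ℤ) : Prop :=
  Indecomposable A ∧ ∃ u : I → ℚ, (∀ i, 0 < u i) ∧ ∀ i, ∑ᶠ j, (A i j : ℚ) * u j = 0

/-- `A` is of indefinite type: `A u < 0` for some `u > 0`. -/
def IsIndefiniteType {I : Type*} (A : Matrix I I ℤ) : Prop :=
  ∃ u : I → ℚ, (∀ i, 0 < u i) ∧ ∀ i, ∑ᶠ j, (A i j : ℚ) * u j < 0

/-- The corank of a generalized Cartan matrix. -/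
def gcmCorank {I : Type*} [Fintype I] [DecidableEq I] (A : Matrix I I ℤ) : ℕ :=
  Fintype.card I - (A.map ((↑) : ℤ → ℚ)).rank

/-- The connected component of the vertex `k` in the subdiagram of the Dynkin diagram of `A`
with vertex set `S`. -/
def cmpnt {I : Type*} (A : Matrix I I ℤ) (S : Set I) (k : I) : Set I :=
  {i | i ∈ S ∧ Relation.ReflTransGen (fun x y => x ∈ S ∧ y ∈ S ∧ A x y ≠ 0) k i}

/-- `A` is hyperbolic: deleting any one vertex of the Dynkin diagram leaves a disjoint union
of diagrams of finite or affine type. -/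
def IsHyperbolic {I : Type*} (A : Matrix I I ℤ) : Prop :=
  ∀ i₀ k : I, k ≠ i₀ →
    IsFiniteType (restrictM A (cmpnt A {i | i ≠ i₀} k)) ∨
      IsAffineType (restrictM A (cmpnt A {i | i ≠ i₀} k))

/-- `A` is Lorentzian: `A` is nonsingular and its symmetrization has signature `(+,...,+,-)`. -/
def IsLorentzian {I : Type*} [Fintype I] [DecidableEq I] (A : Matrix I I ℤ) : Prop :=
  IsUnit (A.map ((↑) : ℤ → ℚ)).det ∧
    ∃ d : I → ℚ, (∀ i, 0 < d i) ∧ (∀ i j, d i * (A i j : ℚ) = d j * (A j i : ℚ)) ∧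
      ∃ P : Matrix I I ℝ, IsUnit P.det ∧ ∃ i₀ : I,
        P.transpose * (Matrix.of fun i j => ((d i : ℝ) * (A i j : ℝ))) * P =
          Matrix.diagonal fun i => if i = i₀ then (-1 : ℝ) else 1

/-! ### Weight spaces -/

variable {g : Type*} [LieRing g] [LieAlgebra ℂ g]

/-- The weight space of weight `χ` for the adjoint action on `g` of a space `V` mapping to `g`
by `ι`. -/
def wtSpaceι {V : Type*} [AddCommGroup V] [Module ℂ V] (ι : V →ₗ[ℂ] g)
    (χ : Module.Dual ℂ V) : Submodule ℂ g where
  carrier := {x | ∀ v : V, ⁅ι v, x⁆ = χ v • x}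
  add_mem' := fun ha hb v => by rw [lie_add, ha v, hb v, smul_add]
  zero_mem' := fun v => by rw [lie_zero, smul_zero]
  smul_mem' := fun c x hx v => by rw [lie_smul, hx v, smul_comm]

/-! ### Kac-Moody algebras -/

/-- A (symmetrizable) Kac-Moody algebra structure on the Lie algebra `g`, for the generalized
Cartan matrix `A` indexed by `I` : a realization `(H, root, coroot)` of `A` together with
Chevalley generators `e i`, `f i` satisfying the Chevalley-Serre relations, such that `g` is
generated by `H` and the `e i, f i`, is diagonalizable under `H`, with `0`-weight space `H`. -/
structure KacMoodyAlgebra {I : Type*} [Fintype I] [DecidableEq I] (A : Matrix I I ℤ)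
    (g : Type*) [LieRing g] [LieAlgebra ℂ g] : Type _ where
  H : Submodule ℂ g
  root : I → Module.Dual ℂ H
  coroot : I → H
  e : I → g
  f : I → g
  findimH : FiniteDimensional ℂ H
  finrankH : Module.finrank ℂ H = Fintype.card I + gcmCorank A
  indepRoot : LinearIndependent ℂ root
  indepCoroot : LinearIndependent ℂ coroot
  pairing : ∀ i j, root j (coroot i) = (A i j : ℂ)
  abelian : ∀ x y : H, ⁅(x : g), (y : g)⁆ = 0
  lie_e : ∀ (x : H) (i : I), ⁅(x : g), e i⁆ = root i x • e i
  lie_f : ∀ (x : H) (i : I), ⁅(x : g), f i⁆ = -(root i x) • f i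
  e_f : ∀ i j, ⁅e i, f j⁆ = if j = i then ((coroot i : g)) else 0
  serre_e : ∀ i j, i ≠ j →
    ((LieAlgebra.ad ℂ g (e i)) ^ (1 - A i j).toNat) (e j) = 0
  serre_f : ∀ i j, i ≠ j →
    ((LieAlgebra.ad ℂ g (f i)) ^ (1 - A i j).toNat) (f j) = 0
  generates : LieSubalgebra.lieSpan ℂ g ((H : Set g) ∪ Set.range e ∪ Set.range f) = ⊤
  weight_decomp : ⨆ χ : Module.Dual ℂ H, wtSpaceι H.subtype χ = ⊤
  zero_weight : wtSpaceι H.subtype (0 : Module.Dual ℂ H) = H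

variable {I : Type*} [Fintype I] [DecidableEq I] {A : Matrix I I ℤ}

/-- The root system of a Kac-Moody algebra: nonzero weights of the adjoint action of the
Cartan subalgebra. -/
def Delta (G : KacMoodyAlgebra A g) : Set (Module.Dual ℂ G.H) :=
  {χ | χ ≠ 0 ∧ wtSpaceι G.H.subtype χ ≠ ⊥}

/-- The positive roots with respect to the standard root basis. -/
def posRoots (G : KacMoodyAlgebra A g) : Set (Module.Dual ℂ G.H) :=
  {χ ∈ Delta G | ∃ c : I → ℕ, χ = ∑ i, (c i : ℂ) • G.root i}

/-- The real roots : the orbit of the simple roots under the Weyl group. -/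
inductive IsRealRoot (G : KacMoodyAlgebra A g) : Module.Dual ℂ G.H → Prop
  | simple (i : I) : IsRealRoot G (G.root i)
  | reflect (i : I) (χ : Module.Dual ℂ G.H) :
      IsRealRoot G χ → IsRealRoot G (χ - χ (G.coroot i) • G.root i)

/-- The subalgebra `g(S)` generated by the root spaces `g_{± α_i}`, `i ∈ S`. -/
def gS (G : KacMoodyAlgebra A g) (S : Set I) : LieSubalgebra ℂ g :=
  LieSubalgebra.lieSpan ℂ g ({x | ∃ i ∈ S, x = G.e i} ∪ {x | ∃ i ∈ S, x = G.f i})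

/-- The subspace `h^J = {h ∈ h | ⟨α_j, h⟩ = 0 ∀ j ∈ J}`. -/
def hJsub (G : KacMoodyAlgebra A g) (J : Set I) : Submodule ℂ G.H :=
  ⨅ j ∈ J, LinearMap.ker (G.root j)

/-- `Hk` is the canonical semisimple element attached to `k` and the component `S = I_k` :
it lies in the span of the coroots from `S` and satisfies `⟨α_i, H_k⟩ = 2 δ_{i,k}` on `S`. -/
def IsHGen (G : KacMoodyAlgebra A g) (S : Set I) (k : I) (Hk : G.H) : Prop :=
  Hk ∈ Submodule.span ℂ (G.coroot '' S) ∧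
    ∀ i ∈ S, G.root i Hk = if i = k then 2 else 0

/-- `g(S)` is `A₁`-graded by the `sl₂`-triple with semisimple element `Hk` :
`ad Hk` has only eigenvalues `0, 2, -2` on `g(S)`. -/
def A1GradedBy (G : KacMoodyAlgebra A g) (S : Set I) (Hk : g) : Prop :=
  ∀ x ∈ gS G S, x ∈ Module.End.eigenspace (LieAlgebra.ad ℂ g Hk) 0 ⊔
    Module.End.eigenspace (LieAlgebra.ad ℂ g Hk) 2 ⊔
      Module.End.eigenspace (LieAlgebra.ad ℂ g Hk) (-2)

/-- The pair `(I_k, J_k)` (for `I_k` the connected component of `k` in `J ∪ {k}`) is an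
irreducible `C`-admissible pair. -/
def CAdmissibleComponent (G : KacMoodyAlgebra A g) (J : Set I) (k : I) : Prop :=
  IsFiniteType (restrictM A (cmpnt A (J ∪ {k}) k)) ∧
    ∃ Hk : G.H, IsHGen G (cmpnt A (J ∪ {k}) k) k Hk ∧
      ∃ E F : g, E ∈ gS G (cmpnt A (J ∪ {k}) k) ∧ F ∈ gS G (cmpnt A (J ∪ {k}) k) ∧
        IsSl2Triple (Hk : g) E F ∧ A1GradedBy G (cmpnt A (J ∪ {k}) k) (Hk : g)

/-- The data of a `C`-admissible pair `(I, J)` : for each `k ∉ J`, the component `I_k` is of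
finite type and carries an `sl₂`-triple `(E_k, H_k, F_k)` which `A₁`-grades `g(I_k)`. -/
structure CAdmissibleData (G : KacMoodyAlgebra A g) (J : Set I) : Type _ where
  finJ : IsFiniteType (restrictM A J)
  Hc : {k : I // k ∉ J} → G.H
  E : {k : I // k ∉ J} → g
  F : {k : I // k ∉ J} → g
  finIk : ∀ k : {k : I // k ∉ J}, IsFiniteType (restrictM A (cmpnt A (J ∪ {k.1}) k.1))
  isHGen : ∀ k, IsHGen G (cmpnt A (J ∪ {k.1}) k.1) k.1 (Hc k)
  memE : ∀ k, E k ∈ gS G (cmpnt A (J ∪ {k.1}) k.1)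
  memF : ∀ k, F k ∈ gS G (cmpnt A (J ∪ {k.1}) k.1)
  sl2 : ∀ k, IsSl2Triple ((Hc k : g)) (E k) (F k)
  a1 : ∀ k, A1GradedBy G (cmpnt A (J ∪ {k.1}) k.1) ((Hc k : g))

/-- `(I,J)` is a `C`-admissible pair. -/
def CAdmissiblePair (G : KacMoodyAlgebra A g) (J : Set I) : Prop :=
  Nonempty (CAdmissibleData G J)

/-- The data of a `C`-admissible pair `(Itot, J)` for a subdiagram `Itot ⊆ I`. -/
structure CAdmissibleDataIn (G : KacMoodyAlgebra A g) (Itot J : Set I) : Type _ where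
  subJ : J ⊆ Itot
  finJ : IsFiniteType (restrictM A J)
  Hc : {k : I // k ∈ Itot ∧ k ∉ J} → G.H
  E : {k : I // k ∈ Itot ∧ k ∉ J} → g
  F : {k : I // k ∈ Itot ∧ k ∉ J} → g
  finIk : ∀ k : {k : I // k ∈ Itot ∧ k ∉ J},
    IsFiniteType (restrictM A (cmpnt A (J ∪ {k.1}) k.1))
  isHGen : ∀ k, IsHGen G (cmpnt A (J ∪ {k.1}) k.1) k.1 (Hc k)
  memE : ∀ k, E k ∈ gS G (cmpnt A (J ∪ {k.1}) k.1)
  memF : ∀ k, F k ∈ gS G (cmpnt A (J ∪ {k.1}) k.1)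
  sl2 : ∀ k, IsSl2Triple ((Hc k : g)) (E k) (F k)
  a1 : ∀ k, A1GradedBy G (cmpnt A (J ∪ {k.1}) k.1) ((Hc k : g))

/-- The `C`-admissible subalgebra `g^J` : generated by `h^J` and the `E_k, F_k`. -/
def CAdmissibleData.gJ {G : KacMoodyAlgebra A g} {J : Set I} (D : CAdmissibleData G J) :
    LieSubalgebra ℂ g :=
  LieSubalgebra.lieSpan ℂ g
    ((((hJsub G J).map G.H.subtype : Submodule ℂ g) : Set g) ∪ Set.range D.E ∪ Set.range D.F)

/-- `GJ` is "the" Kac-Moody structure on `g^J` associated to a `C`-admissible pair: its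
Cartan subalgebra is `h^J`, its coroots are the `H_k` and its Chevalley generators are the
`E_k, F_k`; the matrix `A'` is `A^J`, i.e. `a'_{k,l} = ⟨α_l, H_k⟩`. -/
def CAdmissibleData.IsAssocKM {G : KacMoodyAlgebra A g} {J : Set I} (D : CAdmissibleData G J)
    {A' : Matrix {k : I // k ∉ J} {k : I // k ∉ J} ℤ}
    (GJ : KacMoodyAlgebra A' ↥D.gJ) : Prop :=
  (∀ k l, (A' k l : ℂ) = G.root l.1 (D.Hc k)) ∧
  GJ.H.map D.gJ.toSubmodule.subtype = (hJsub G J).map G.H.subtype ∧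
  (∀ k, ((GJ.coroot k : ↥D.gJ) : g) = ((D.Hc k : ↥G.H) : g)) ∧
  (∀ k, ((GJ.e k : ↥D.gJ) : g) = D.E k) ∧ (∀ k, ((GJ.f k : ↥D.gJ) : g) = D.F k)

/-! ### Finite gradations -/

/-- `g` is finitely `Σ`-graded, where `Σ` is the root system of the Kac-Moody algebra `m`
(with Kac-Moody structure `M`) and `m` is embedded in `g` by `φ` (the grading subalgebra is
the image of `φ`): `g` is the sum of the weight spaces `V_γ`, `γ ∈ Σ ∪ {0}`, of the adjoint
action of the Cartan subalgebra of `m`, and each `V_γ` is finite dimensional. -/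
def IsFinGrading {S : Type*} [Fintype S] [DecidableEq S] {B : Matrix S S ℤ}
    {m : Type*} [LieRing m] [LieAlgebra ℂ m] (M : KacMoodyAlgebra B m)
    (φ : m →ₗ⁅ℂ⁆ g) : Prop :=
  Function.Injective φ ∧
  (⨆ χ ∈ insert (0 : Module.Dual ℂ M.H) (Delta M),
      wtSpaceι (φ.toLinearMap ∘ₗ M.H.subtype) χ) = ⊤ ∧
  ∀ χ ∈ insert (0 : Module.Dual ℂ M.H) (Delta M),
      FiniteDimensional ℂ (wtSpaceι (φ.toLinearMap ∘ₗ M.H.subtype) χ)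

section Grading

variable {S : Type*} [Fintype S] [DecidableEq S] {B : Matrix S S ℤ}
variable {m : Type*} [LieRing m] [LieAlgebra ℂ m]

/-- The inclusion of the Cartan subalgebra of the grading subalgebra into the Cartan
subalgebra of `g` (given `a ⊆ h`). -/
def cartanIncl (G : KacMoodyAlgebra A g) (M : KacMoodyAlgebra B m) (φ : m →ₗ⁅ℂ⁆ g)
    (hle : M.H.map φ.toLinearMap ≤ G.H) : M.H →ₗ[ℂ] G.H :=
  LinearMap.codRestrict G.H (φ.toLinearMap ∘ₗ M.H.subtype)
    (fun x => hle (Submodule.mem_map_of_mem x.2))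

/-- The restriction `ρ_a(χ)` to the Cartan subalgebra `a` of `m` of a linear form `χ` on `h`. -/
def resD (G : KacMoodyAlgebra A g) (M : KacMoodyAlgebra B m) (φ : m →ₗ⁅ℂ⁆ g)
    (hle : M.H.map φ.toLinearMap ≤ G.H) (χ : Module.Dual ℂ G.H) : Module.Dual ℂ M.H :=
  χ.comp (cartanIncl G M φ hle)

/-- The restriction `ρ_a(α_i)` of the simple root `α_i` to `a`. -/
def resRoot (G : KacMoodyAlgebra A g) (M : KacMoodyAlgebra B m) (φ : m →ₗ⁅ℂ⁆ g)
    (hle : M.H.map φ.toLinearMap ≤ G.H) (i : I) : Module.Dual ℂ M.H :=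
  resD G M φ hle (G.root i)

/-- The root basis of `M` is adapted to the root basis of `G` :
`ρ_a(Δ⁺) ⊆ Σ⁺ ∪ {0}`. -/
def Adapted (G : KacMoodyAlgebra A g) (M : KacMoodyAlgebra B m) (φ : m →ₗ⁅ℂ⁆ g)
    (hle : M.H.map φ.toLinearMap ≤ G.H) : Prop :=
  ∀ χ ∈ posRoots G, resD G M φ hle χ = 0 ∨ resD G M φ hle χ ∈ posRoots M

/-- The set `J = {i ∈ I | ρ_a(α_i) = 0}`. -/
def Jof (G : KacMoodyAlgebra A g) (M : KacMoodyAlgebra B m) (φ : m →ₗ⁅ℂ⁆ g)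
    (hle : M.H.map φ.toLinearMap ≤ G.H) : Set I :=
  {i | resRoot G M φ hle i = 0}

/-- The set `Γ_s = {i ∈ I' | ρ_a(α_i) = γ_s}`. -/
def GammaOf (G : KacMoodyAlgebra A g) (M : KacMoodyAlgebra B m) (φ : m →ₗ⁅ℂ⁆ g)
    (hle : M.H.map φ.toLinearMap ≤ G.H) (s : S) : Set I :=
  {i | resRoot G M φ hle i = M.root s}

/-- The set `I'_re = {i ∈ I' | ρ_a(α_i) ∈ Π_a}`. -/
def IpRe (G : KacMoodyAlgebra A g) (M : KacMoodyAlgebra B m) (φ : m →ₗ⁅ℂ⁆ g)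
    (hle : M.H.map φ.toLinearMap ≤ G.H) : Set I :=
  {i | ∃ s : S, resRoot G M φ hle i = M.root s}

/-- The set `I'_im = {i ∈ I | ρ_a(α_i) ∉ Π_a ∪ {0}}`. -/
def IpIm (G : KacMoodyAlgebra A g) (M : KacMoodyAlgebra B m) (φ : m →ₗ⁅ℂ⁆ g)
    (hle : M.H.map φ.toLinearMap ≤ G.H) : Set I :=
  {i | resRoot G M φ hle i ≠ 0 ∧ ∀ s : S, resRoot G M φ hle i ≠ M.root s}

/-- The set `I_re` : union of the components `I_k`, `k ∈ I'_re`. -/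
def IreOf (G : KacMoodyAlgebra A g) (M : KacMoodyAlgebra B m) (φ : m →ₗ⁅ℂ⁆ g)
    (hle : M.H.map φ.toLinearMap ≤ G.H) : Set I :=
  {i | ∃ k ∈ IpRe G M φ hle, i ∈ cmpnt A (Jof G M φ hle ∪ {k}) k}

/-- `g` is maximally finitely graded: finitely graded, with `a ⊆ h`, the root basis of the
grading subalgebra adapted, and the corresponding sets `J` and `I'_im` empty. -/
def MaxFinGrading (G : KacMoodyAlgebra A g) (M : KacMoodyAlgebra B m) (φ : m →ₗ⁅ℂ⁆ g) : Prop :=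
  IsFinGrading M φ ∧ ∃ hle : M.H.map φ.toLinearMap ≤ G.H,
    Adapted G M φ hle ∧ Jof G M φ hle = ∅ ∧ IpIm G M φ hle = ∅

end Grading

/-- `(π, πv)` is a root basis (with generalized Cartan matrix `B`) of the root system `Rts`. -/
def IsRootBasis {V : Type*} [AddCommGroup V] [Module ℂ V] {S : Type*} [Fintype S]
    (B : Matrix S S ℤ) (Rts : Set (Module.Dual ℂ V)) (π : S → Module.Dual ℂ V)
    (πv : S → V) : Prop :=
  LinearIndependent ℂ π ∧ LinearIndependent ℂ πv ∧
  (∀ s t, π t (πv s) = (B s t : ℂ)) ∧ (∀ s, π s ∈ Rts) ∧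
  ∀ χ ∈ Rts, (∃ c : S → ℕ, χ = ∑ s, (c s : ℂ) • π s) ∨
    (∃ c : S → ℕ, χ = -∑ s, (c s : ℂ) • π s)

/-- `Bf` is a nondegenerate invariant symmetric bilinear form on `g`. -/
def InvariantForm (Bf : g →ₗ[ℂ] g →ₗ[ℂ] ℂ) : Prop :=
  (∀ x y, Bf x y = Bf y x) ∧ (∀ x y z, Bf ⁅x, y⁆ z = Bf x ⁅y, z⁆) ∧
  ∀ x, (∀ y, Bf x y = 0) → x = 0

/-- `Bf` is "the" invariant bilinear form of the Kac-Moody algebra `G` : nondegenerate,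
invariant, symmetric, with `(α_i∨, α_i∨)` a positive rational for all `i`. -/
def NormalizedInvForm (G : KacMoodyAlgebra A g) (Bf : g →ₗ[ℂ] g →ₗ[ℂ] ℂ) : Prop :=
  InvariantForm Bf ∧ ∀ i : I, ∃ q : ℚ, 0 < q ∧ Bf ((G.coroot i : g)) ((G.coroot i : g)) = (q : ℂ)

/-- `(e', f')` is a system of Chevalley generators for `G` (with the given Cartan subalgebra,
simple roots and coroots). -/
def IsChevalleyGens (G : KacMoodyAlgebra A g) (e' f' : I → g) : Prop :=
  (∀ (x : G.H) (i : I), ⁅(x : g), e' i⁆ = G.root i x • e' i) ∧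
  (∀ (x : G.H) (i : I), ⁅(x : g), f' i⁆ = -(G.root i x) • f' i) ∧
  (∀ i j, ⁅e' i, f' j⁆ = if j = i then ((G.coroot i : g)) else 0) ∧
  (∀ i j, i ≠ j → ((LieAlgebra.ad ℂ g (e' i)) ^ (1 - A i j).toNat) (e' j) = 0) ∧
  (∀ i j, i ≠ j → ((LieAlgebra.ad ℂ g (f' i)) ^ (1 - A i j).toNat) (f' j) = 0) ∧
  LieSubalgebra.lieSpan ℂ g ((G.H : Set g) ∪ Set.range e' ∪ Set.range f') = ⊤


/-- The subalgebra `g(I_re)` of `g` generated by `h_{I_re}` and the `e_i, f_i`, `i ∈ I_re`. -/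
def gIre (G : KacMoodyAlgebra A g) (Ire : Set I) (hIre : Submodule ℂ g) : LieSubalgebra ℂ g :=
  LieSubalgebra.lieSpan ℂ g
    ((hIre : Set g) ∪ {x | ∃ i ∈ Ire, x = G.e i} ∪ {x | ∃ i ∈ Ire, x = G.f i})

/-- `GI` is "the" Kac-Moody structure on `g(I_re)` : its Cartan subalgebra is `h_{I_re}`,
its coroots and Chevalley generators are the `α_i∨, e_i, f_i` of `g`, for `i ∈ I_re`. -/
def IsAssocKMIre (G : KacMoodyAlgebra A g) (Ire : Set I) (hIre : Submodule ℂ g)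
    {A'' : Matrix ↥Ire ↥Ire ℤ} (GI : KacMoodyAlgebra A'' ↥(gIre G Ire hIre)) : Prop :=
  GI.H.map (gIre G Ire hIre).toSubmodule.subtype = hIre ∧
  (∀ i, ((GI.coroot i : ↥(gIre G Ire hIre)) : g) = ((G.coroot i.1 : ↥G.H) : g)) ∧
  (∀ i, ((GI.e i : ↥(gIre G Ire hIre)) : g) = G.e i.1) ∧
  (∀ i, ((GI.f i : ↥(gIre G Ire hIre)) : g) = G.f i.1)

/-! ### Admissible quotients and maximal gradations -/

/-- `ρ : I → S` is an admissible quotient map for `A` : fibers are totally disconnected (MG1)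
and the column sums over a fiber are constant along fibers (MG2). -/
def AdmissibleQuotient {I S : Type*} (A : Matrix I I ℤ) (ρ : I → S) : Prop :=
  Function.Surjective ρ ∧
  (∀ k l, k ≠ l → ρ k = ρ l → A k l = 0) ∧
  ∀ s t : S, s ≠ t → ∀ j j', ρ j = t → ρ j' = t →
    ∑ᶠ i ∈ {i | ρ i = s}, A i j = ∑ᶠ i ∈ {i | ρ i = s}, A i j'

section Quotient

variable {S : Type*} [Fintype S] [DecidableEq S]

/-- `γ_s∨ = ∑_{k ∈ Γ_s} α_k∨`. -/
def gammaV (G : KacMoodyAlgebra A g) (ρ : I → S) (s : S) : G.H :=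
  ∑ᶠ k ∈ {k | ρ k = s}, G.coroot k

/-- `X̄_s = ∑_{k ∈ Γ_s} e_k`. -/
def Xbar (G : KacMoodyAlgebra A g) (ρ : I → S) (s : S) : g :=
  ∑ᶠ k ∈ {k | ρ k = s}, G.e k

/-- `Ȳ_s = ∑_{k ∈ Γ_s} f_k`. -/
def Ybar (G : KacMoodyAlgebra A g) (ρ : I → S) (s : S) : g :=
  ∑ᶠ k ∈ {k | ρ k = s}, G.f k

/-- The subalgebra `g^ρ` generated by `a` and the `X̄_s, Ȳ_s`. -/
def gRho (G : KacMoodyAlgebra A g) (ρ : I → S) (a : Submodule ℂ G.H) : LieSubalgebra ℂ g :=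
  LieSubalgebra.lieSpan ℂ g
    (((a.map G.H.subtype : Submodule ℂ g) : Set g) ∪ Set.range (Xbar G ρ) ∪
      Set.range (Ybar G ρ))

/-- `Gρ` is "the" Kac-Moody structure on `g^ρ` : its Cartan subalgebra is `a`, its coroots
are the `γ_s∨` and its Chevalley generators are the `X̄_s, Ȳ_s`. -/
def IsAssocKMrho (G : KacMoodyAlgebra A g) (ρ : I → S) (a : Submodule ℂ G.H)
    {Abar : Matrix S S ℤ} (Gρ : KacMoodyAlgebra Abar ↥(gRho G ρ a)) : Prop :=
  Gρ.H.map (gRho G ρ a).toSubmodule.subtype = a.map G.H.subtype ∧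
  (∀ s, ((Gρ.coroot s : ↥(gRho G ρ a)) : g) = ((gammaV G ρ s : ↥G.H) : g)) ∧
  (∀ s, ((Gρ.e s : ↥(gRho G ρ a)) : g) = Xbar G ρ s) ∧
  (∀ s, ((Gρ.f s : ↥(gRho G ρ a)) : g) = Ybar G ρ s)

end Quotient

end KMG


namespace KMG

open Module

section LieAux

variable {L : Type*} [LieRing L] [LieAlgebra ℂ L]

theorem lieSpan_le_submodule {X : Set L} {N : Submodule ℂ L} (hX : ∀ x ∈ X, x ∈ N)
    (hN : ∀ x ∈ N, ∀ y ∈ N, ⁅x, y⁆ ∈ N) {x : L} (hx : x ∈ LieSubalgebra.lieSpan ℂ L X) :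
    x ∈ N := by
  let K : LieSubalgebra ℂ L := { N with lie_mem' := fun {x y} hx hy => hN x hx y hy }
  exact (LieSubalgebra.lieSpan_le (K := K)).2 hX hx

theorem lieSpan_stabilizes {X : Set L} {N : Submodule ℂ L}
    (hX : ∀ x ∈ X, ∀ y ∈ N, ⁅x, y⁆ ∈ N) {x : L} (hx : x ∈ LieSubalgebra.lieSpan ℂ L X) :
    ∀ y ∈ N, ⁅x, y⁆ ∈ N := by
  induction hx using LieSubalgebra.lieSpan_induction with
  | mem x hx => exact hX x hx
  | zero => intro y _; rw [zero_lie]; exact N.zero_mem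
  | add a b _ _ ha hb => intro y hy; rw [add_lie]; exact N.add_mem (ha y hy) (hb y hy)
  | smul c a _ ha => intro y hy; rw [smul_lie]; exact N.smul_mem c (ha y hy)
  | lie a b _ _ ha hb =>
    intro y hy
    rw [lie_lie]
    exact N.sub_mem (ha _ (hb y hy)) (hb _ (ha y hy))

theorem lieSpan_le_of_stable {X : Set L} {N : Submodule ℂ L} (hXN : ∀ x ∈ X, x ∈ N)
    (hX : ∀ x ∈ X, ∀ y ∈ N, ⁅x, y⁆ ∈ N) {x : L} (hx : x ∈ LieSubalgebra.lieSpan ℂ L X) :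
    x ∈ N := by
  induction hx using LieSubalgebra.lieSpan_induction with
  | mem x hx => exact hXN x hx
  | zero => exact N.zero_mem
  | add a b _ _ ha hb => exact N.add_mem ha hb
  | smul c a _ ha => exact N.smul_mem c ha
  | lie a b ha _ _ hb => exact lieSpan_stabilizes hX ha _ hb

theorem lie_eq_zero_of_lieSpan {X : Set L} {y : L} (hX : ∀ x ∈ X, ⁅y, x⁆ = 0) {x : L}
    (hx : x ∈ LieSubalgebra.lieSpan ℂ L X) : ⁅y, x⁆ = 0 := by
  induction hx using LieSubalgebra.lieSpan_induction with
  | mem x hx => exact hX x hx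
  | zero => exact lie_zero y
  | add a b _ _ ha hb => rw [lie_add, ha, hb, add_zero]
  | smul c a _ ha => rw [lie_smul, ha, smul_zero]
  | lie a b _ _ ha hb => rw [leibniz_lie, ha, hb, zero_lie, lie_zero, add_zero]

/-- The sum of the eigenspaces of `ad d` for the eigenvalues in `s`. -/
def grd (d : L) (s : Set ℂ) : Submodule ℂ L :=
  Submodule.span ℂ {x | ∃ c ∈ s, ⁅d, x⁆ = c • x}

theorem mem_grd {d x : L} {s : Set ℂ} {c : ℂ} (hc : c ∈ s) (hx : ⁅d, x⁆ = c • x) :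
    x ∈ grd d s :=
  Submodule.subset_span ⟨c, hc, hx⟩

theorem grd_mono (d : L) {s t : Set ℂ} (h : s ⊆ t) : grd d s ≤ grd d t :=
  Submodule.span_mono fun _ ⟨c, hc, hx⟩ => ⟨c, h hc, hx⟩

theorem lie_mem_grd {d : L} {s t u : Set ℂ} (h : ∀ a ∈ s, ∀ b ∈ t, a + b ∈ u) {x y : L}
    (hx : x ∈ grd d s) (hy : y ∈ grd d t) : ⁅x, y⁆ ∈ grd d u := by
  induction hx using Submodule.span_induction with
  | zero => rw [zero_lie]; exact Submodule.zero_mem _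
  | add a b _ _ ha hb => rw [add_lie]; exact Submodule.add_mem _ ha hb
  | smul c a _ ha => rw [smul_lie]; exact Submodule.smul_mem _ c ha
  | mem x hx =>
    obtain ⟨a, ha, hx⟩ := hx
    induction hy using Submodule.span_induction with
    | zero => rw [lie_zero]; exact Submodule.zero_mem _
    | add a b _ _ ha hb => rw [lie_add]; exact Submodule.add_mem _ ha hb
    | smul c a _ ha => rw [lie_smul]; exact Submodule.smul_mem _ c ha
    | mem y hy =>
      obtain ⟨b, hb, hy⟩ := hy
      refine mem_grd (h a ha b hb) ?_
      rw [leibniz_lie, hx, hy, smul_lie, lie_smul, add_smul]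

theorem disjoint_grd (d : L) {s t : Set ℂ} (h : Disjoint s t) :
    Disjoint (grd d s) (grd d t) := by
  have key := (LieAlgebra.ad ℂ L d).eigenspaces_iSupIndep.disjoint_biSup_biSup h
  refine key.mono ?_ ?_ <;>
  · refine Submodule.span_le.2 ?_
    rintro x ⟨c, hc, hx⟩
    exact Submodule.mem_iSup_of_mem c (Submodule.mem_iSup_of_mem hc
      (End.mem_eigenspace_iff.2 hx))

theorem eq_zero_of_mem_grd {d x : L} {s t : Set ℂ} (h : Disjoint s t)
    (hs : x ∈ grd d s) (ht : x ∈ grd d t) : x = 0 :=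
  Submodule.disjoint_def.1 (disjoint_grd d h) x hs ht

/-- The natural numbers `≥ n`, in `ℂ`. -/
def upC (n : ℕ) : Set ℂ := {c | ∃ k : ℕ, n ≤ k ∧ c = k}

/-- The nonpositive integers, in `ℂ`. -/
def dnC : Set ℂ := {c | ∃ k : ℕ, c = -k}

theorem add_mem_upC {p q r : ℕ} (h : r ≤ p + q) :
    ∀ a ∈ upC p, ∀ b ∈ upC q, a + b ∈ upC r := by
  rintro _ ⟨k, hk, rfl⟩ _ ⟨l, hl, rfl⟩
  exact ⟨k + l, by omega, by push_cast; rfl⟩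

theorem add_mem_dnC : ∀ a ∈ dnC, ∀ b ∈ dnC, a + b ∈ dnC := by
  rintro _ ⟨k, rfl⟩ _ ⟨l, rfl⟩
  exact ⟨k + l, by push_cast; ring⟩

end LieAux

section Weights

variable {L V : Type*} [LieRing L] [LieAlgebra ℂ L] [AddCommGroup V] [Module ℂ V]
  {ι : V →ₗ[ℂ] L}

theorem lie_mem_wtSpace {χ ψ : Dual ℂ V} {x y : L} (hx : x ∈ wtSpaceι ι χ)
    (hy : y ∈ wtSpaceι ι ψ) : ⁅x, y⁆ ∈ wtSpaceι ι (χ + ψ) := fun v => by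
  rw [leibniz_lie, hx v, hy v, smul_lie, lie_smul, LinearMap.add_apply, add_smul]

theorem wtSpace_eq_bot {Φ : Set (Dual ℂ V)} (hab : ∀ v w, ⁅ι v, ι w⁆ = 0)
    (htop : ⨆ χ ∈ Φ, wtSpaceι ι χ = ⊤) {χ : Dual ℂ V} (hχ : χ ∉ Φ) : wtSpaceι ι χ = ⊥ := by
  have hcomm (v w : V) : Commute (LieAlgebra.ad ℂ L (ι v)) (LieAlgebra.ad ℂ L (ι w)) := by
    refine LinearMap.ext fun x => ?_
    have h := leibniz_lie (ι v) (ι w) x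
    rwa [hab, zero_lie, zero_add] at h
  have hind := End.independent_iInf_maxGenEigenspace_of_forall_mapsTo
    (fun v : V => LieAlgebra.ad ℂ L (ι v))
    (fun v w c => End.mapsTo_maxGenEigenspace_of_comm (hcomm w v) c)
  have hwt (ψ : Dual ℂ V) : wtSpaceι ι ψ ≤
      ⨅ v, (LieAlgebra.ad ℂ L (ι v)).maxGenEigenspace (ψ v) := by
    refine le_iInf fun v x hx => ?_
    exact (End.mem_maxGenEigenspace _ _ _).2 ⟨1, by simp [hx v]⟩
  have hdis := (hind.disjoint_biSup (x := (χ : V → ℂ)) (y := (fun ψ : Dual ℂ V => (ψ : V → ℂ)) '' Φ)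
    (by rintro ⟨ψ, hψ, h⟩; exact hχ (DFunLike.coe_injective h ▸ hψ)))
  have : (⊤ : Submodule ℂ L) ≤ ⨆ i ∈ (fun ψ : Dual ℂ V => (ψ : V → ℂ)) '' Φ,
      ⨅ v, (LieAlgebra.ad ℂ L (ι v)).maxGenEigenspace (i v) := by
    rw [← htop]
    refine iSup₂_le fun ψ hψ => (hwt ψ).trans ?_
    exact le_iSup₂_of_le (ψ : V → ℂ) ⟨ψ, hψ, rfl⟩ le_rfl
  rw [top_le_iff.1 this, disjoint_top] at hdis
  exact le_bot_iff.1 ((hwt χ).trans hdis.le)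

theorem exists_forall_dual_eq {J : Type*} [Fintype J] [FiniteDimensional ℂ V]
    {r : J → Dual ℂ V} (hr : LinearIndependent ℂ r) (c : J → ℂ) : ∃ v, ∀ j, r j v = c j := by
  obtain ⟨f, hf⟩ : ∃ f : Dual ℂ V →ₗ[ℂ] ℂ, ∀ j, f (r j) = c j := by
    obtain ⟨f, hf⟩ := LinearMap.exists_extend ((Basis.span hr).constr ℂ c)
    refine ⟨f, fun j => ?_⟩
    have h1 := LinearMap.congr_fun hf (Basis.span hr j)
    rw [Basis.constr_basis, LinearMap.comp_apply, Submodule.subtype_apply,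
      Basis.span_apply] at h1
    exact h1
  refine ⟨(evalEquiv ℂ V).symm f, fun j => ?_⟩
  rw [apply_evalEquiv_symm_apply, hf]

end Weights

end KMG
namespace KMG

open Module

section KacMoody

variable {I : Type*} [Fintype I] [DecidableEq I] {A : Matrix I I ℤ}
variable {g : Type*} [LieRing g] [LieAlgebra ℂ g]

/-- The Kac-Moody structure with the roles of the `e i` and `f i` exchanged. -/
def flipKM (G : KacMoodyAlgebra A g) : KacMoodyAlgebra A g where
  H := G.H
  root i := -G.root i
  coroot i := -G.coroot i
  e := G.f
  f := G.e
  findimH := G.findimH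
  finrankH := G.finrankH
  indepRoot := G.indepRoot.neg
  indepCoroot := G.indepCoroot.neg
  pairing i j := by simp [G.pairing]
  abelian := G.abelian
  lie_e x i := by simp [G.lie_f]
  lie_f x i := by simp [G.lie_e]
  e_f i j := by
    rw [← lie_skew, G.e_f]
    by_cases h : i = j
    · subst h; simp
    · simp [h, Ne.symm h]
  serre_e := G.serre_f
  serre_f := G.serre_e
  generates := by
    rw [← G.generates]
    congr 1
    rw [Set.union_assoc, Set.union_assoc, Set.union_comm (Set.range G.f)]
  weight_decomp := G.weight_decomp
  zero_weight := G.zero_weight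

variable (G : KacMoodyAlgebra A g)

theorem gS_flip (T : Set I) : gS (flipKM G) T = gS G T := by
  unfold gS
  rw [Set.union_comm]
  rfl

/-- The subalgebra generated by the `e i`, `i ∈ T`. -/
def nP (T : Set I) : LieSubalgebra ℂ g := LieSubalgebra.lieSpan ℂ g (G.e '' T)

variable {G}

theorem e_mem_nP {T : Set I} {i : I} (hi : i ∈ T) : G.e i ∈ nP G T :=
  LieSubalgebra.subset_lieSpan ⟨i, hi, rfl⟩

theorem nP_mono {T U : Set I} (h : T ⊆ U) : nP G T ≤ nP G U :=
  LieSubalgebra.lieSpan_mono (Set.image_mono h)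

theorem e_mem_gS {T : Set I} {i : I} (hi : i ∈ T) : G.e i ∈ gS G T :=
  LieSubalgebra.subset_lieSpan (Or.inl ⟨i, hi, rfl⟩)

theorem f_mem_gS {T : Set I} {i : I} (hi : i ∈ T) : G.f i ∈ gS G T :=
  LieSubalgebra.subset_lieSpan (Or.inr ⟨i, hi, rfl⟩)

theorem gS_mono {T U : Set I} (h : T ⊆ U) : gS G T ≤ gS G U := by
  refine LieSubalgebra.lieSpan_mono ?_
  rintro x (⟨i, hi, rfl⟩ | ⟨i, hi, rfl⟩)
  · exact Or.inl ⟨i, h hi, rfl⟩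
  · exact Or.inr ⟨i, h hi, rfl⟩

theorem nP_le_gS (T : Set I) : nP G T ≤ gS G T := by
  refine LieSubalgebra.lieSpan_le.2 ?_
  rintro _ ⟨i, hi, rfl⟩
  exact e_mem_gS hi

theorem lie_e_f_self (i : I) : ⁅G.e i, G.f i⁆ = G.coroot i := by
  rw [G.e_f, if_pos rfl]

theorem lie_f_e_self (i : I) : ⁅G.f i, G.e i⁆ = -(G.coroot i : g) := by
  rw [← lie_skew, lie_e_f_self]

theorem lie_e_f_ne {i j : I} (h : i ≠ j) : ⁅G.e i, G.f j⁆ = 0 := by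
  rw [G.e_f, if_neg (Ne.symm h)]

theorem lie_f_e_ne {i j : I} (h : i ≠ j) : ⁅G.f i, G.e j⁆ = 0 := by
  rw [← lie_skew, lie_e_f_ne (Ne.symm h), neg_zero]

theorem e_ne_zero (i : I) : G.e i ≠ 0 := by
  intro h
  have h1 := lie_e_f_self (G := G) i
  rw [h, zero_lie] at h1
  exact G.indepCoroot.ne_zero i (Subtype.ext h1.symm)

theorem lie_coroot_e (hA : IsGCM A) (i : I) : ⁅(G.coroot i : g), G.e i⁆ = (2 : ℂ) • G.e i := by
  rw [G.lie_e, G.pairing, hA.1 i]; norm_num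

theorem lie_nP_mem {T : Set I} {h : g} (hh : h ∈ G.H) {x : g} (hx : x ∈ nP G T) :
    ⁅h, x⁆ ∈ nP G T := by
  unfold nP at hx
  induction hx using LieSubalgebra.lieSpan_induction with
  | mem x hx =>
    obtain ⟨i, hi, rfl⟩ := hx
    rw [G.lie_e ⟨h, hh⟩ i]
    exact (nP G T).smul_mem _ (e_mem_nP hi)
  | zero => rw [lie_zero]; exact (nP G T).zero_mem
  | add a b _ _ ha hb => rw [lie_add]; exact (nP G T).add_mem ha hb
  | smul c a _ ha => rw [lie_smul]; exact (nP G T).smul_mem c ha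
  | lie a b ha' hb' ha hb =>
    rw [leibniz_lie]
    exact (nP G T).add_mem ((nP G T).lie_mem ha hb') ((nP G T).lie_mem ha' hb)

theorem lie_f_nP_mem {T : Set I} {K : Submodule ℂ g} (hK : K ≤ G.H) {i : I}
    (hi : (G.coroot i : g) ∈ K) {x : g} (hx : x ∈ nP G T) :
    ⁅G.f i, x⁆ ∈ (nP G T).toSubmodule ⊔ K := by
  have hmix {u v : g} (hu : u ∈ (nP G T).toSubmodule ⊔ K) (hv : v ∈ nP G T) :
      ⁅u, v⁆ ∈ (nP G T).toSubmodule ⊔ K := by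
    obtain ⟨a, ha, b, hb, rfl⟩ := Submodule.mem_sup.1 hu
    rw [add_lie]
    exact Submodule.mem_sup_left
      (Submodule.add_mem _ ((nP G T).lie_mem ha hv) (lie_nP_mem (hK hb) hv))
  have key := hx
  unfold nP at key
  induction key using LieSubalgebra.lieSpan_induction with
  | mem x hxe =>
    obtain ⟨j, hj, rfl⟩ := hxe
    by_cases h : i = j
    · subst h
      rw [lie_f_e_self]
      exact Submodule.mem_sup_right (K.neg_mem hi)
    · rw [lie_f_e_ne h]; exact Submodule.zero_mem _
  | zero => rw [lie_zero]; exact Submodule.zero_mem _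
  | add a b ha' hb' ha hb => rw [lie_add]; exact Submodule.add_mem _ (ha ha') (hb hb')
  | smul c a ha' ha => rw [lie_smul]; exact Submodule.smul_mem _ c (ha ha')
  | lie a b ha' hb' ha hb =>
    rw [leibniz_lie, ← lie_skew a]
    exact Submodule.add_mem _ (hmix (ha ha') hb') (Submodule.neg_mem _ (hmix (hb hb') ha'))

/-- Triangular decomposition of the subalgebra generated by `K ⊆ H` and the `e i, f i`,
`i ∈ T`. -/
theorem mem_triangular {T : Set I} {K : Submodule ℂ g} (hK : K ≤ G.H)
    (hT : ∀ i ∈ T, (G.coroot i : g) ∈ K) {x : g}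
    (hx : x ∈ LieSubalgebra.lieSpan ℂ g ((K : Set g) ∪ G.e '' T ∪ G.f '' T)) :
    ∃ a ∈ nP (flipKM G) T, ∃ h ∈ K, ∃ b ∈ nP G T, x = a + h + b := by
  suffices hx' : x ∈ (nP (flipKM G) T).toSubmodule ⊔ K ⊔ (nP G T).toSubmodule by
    obtain ⟨y, hy, b, hb, rfl⟩ := Submodule.mem_sup.1 hx'
    obtain ⟨a, ha, h, hh, rfl⟩ := Submodule.mem_sup.1 hy
    exact ⟨a, ha, h, hh, b, hb, rfl⟩
  refine lieSpan_le_of_stable ?_ ?_ hx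
  · rintro x ((hx | ⟨i, hi, rfl⟩) | ⟨i, hi, rfl⟩)
    · exact Submodule.mem_sup_left (Submodule.mem_sup_right hx)
    · exact Submodule.mem_sup_right (e_mem_nP hi)
    · exact Submodule.mem_sup_left (Submodule.mem_sup_left (e_mem_nP (G := flipKM G) hi))
  · intro x hx y hy
    obtain ⟨z, hz, b, hb, rfl⟩ := Submodule.mem_sup.1 hy
    obtain ⟨a, ha, h, hh, rfl⟩ := Submodule.mem_sup.1 hz
    rw [lie_add, lie_add]
    rcases hx with (hx | ⟨i, hi, rfl⟩) | ⟨i, hi, rfl⟩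
    · refine Submodule.add_mem _ (Submodule.add_mem _ ?_ ?_) ?_
      · exact Submodule.mem_sup_left (Submodule.mem_sup_left
          (lie_nP_mem (G := flipKM G) (hK hx) ha))
      · rw [G.abelian ⟨x, hK hx⟩ ⟨h, hK hh⟩]; exact Submodule.zero_mem _
      · exact Submodule.mem_sup_right (lie_nP_mem (hK hx) hb)
    · refine Submodule.add_mem _ (Submodule.add_mem _ ?_ ?_) ?_
      · refine Submodule.mem_sup_left (lie_f_nP_mem (G := flipKM G) hK (i := i) ?_ ha)
        exact K.neg_mem (hT i hi)
      · rw [← lie_skew, G.lie_e ⟨h, hK hh⟩]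
        exact Submodule.mem_sup_right (Submodule.neg_mem _ (Submodule.smul_mem _ _ (e_mem_nP hi)))
      · exact Submodule.mem_sup_right ((nP G T).lie_mem (e_mem_nP hi) hb)
    · refine Submodule.add_mem _ (Submodule.add_mem _ ?_ ?_) ?_
      · exact Submodule.mem_sup_left (Submodule.mem_sup_left
          ((nP (flipKM G) T).lie_mem (e_mem_nP (G := flipKM G) hi) ha))
      · rw [← lie_skew, G.lie_f ⟨h, hK hh⟩]
        exact Submodule.mem_sup_left (Submodule.mem_sup_left (Submodule.neg_mem _
          (Submodule.smul_mem _ _ (e_mem_nP (G := flipKM G) hi))))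
      · have := lie_f_nP_mem (T := T) hK (hT i hi) hb
        rw [sup_assoc]
        rw [sup_comm] at this
        exact Submodule.mem_sup_right this

theorem exists_triangular (x : g) :
    ∃ a ∈ nP (flipKM G) Set.univ, ∃ h ∈ G.H, ∃ b ∈ nP G Set.univ, x = a + h + b := by
  refine mem_triangular le_rfl (fun i _ => (G.coroot i).2) ?_
  rw [Set.image_univ, Set.image_univ, G.generates]
  exact LieSubalgebra.mem_top x

theorem exists_triangular_gS {T : Set I} {x : g} (hx : x ∈ gS G T) :
    ∃ a ∈ nP (flipKM G) T, ∃ h ∈ (Submodule.span ℂ (G.coroot '' T)).map G.H.subtype,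
      ∃ b ∈ nP G T, x = a + h + b := by
  refine mem_triangular (Submodule.map_subtype_le _ _) (fun i hi => ?_) ?_
  · exact ⟨G.coroot i, Submodule.subset_span ⟨i, hi, rfl⟩, rfl⟩
  · refine LieSubalgebra.lieSpan_mono ?_ hx
    rintro x (⟨i, hi, rfl⟩ | ⟨i, hi, rfl⟩)
    · exact Or.inl (Or.inr ⟨i, hi, rfl⟩)
    · exact Or.inr ⟨i, hi, rfl⟩

theorem nP_le_grd {T : Set I} (d : G.H) {s : Set ℂ} (hs : ∀ a ∈ s, ∀ b ∈ s, a + b ∈ s)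
    (h : ∀ i ∈ T, G.root i d ∈ s) {x : g} (hx : x ∈ nP G T) : x ∈ grd (d : g) s := by
  refine lieSpan_le_submodule ?_ (fun x hx y hy => lie_mem_grd hs hx hy) hx
  rintro _ ⟨i, hi, rfl⟩
  exact mem_grd (h i hi) (G.lie_e d i)

theorem exists_root_eq (c : I → ℂ) : ∃ d : G.H, ∀ i, G.root i d = c i :=
  haveI := G.findimH
  exists_forall_dual_eq G.indepRoot c

theorem cartan_le_grd (d : G.H) {x : g} (hx : x ∈ G.H) : x ∈ grd (d : g) {0} :=
  mem_grd rfl (by rw [zero_smul]; exact G.abelian d ⟨x, hx⟩)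

/-- If every `e i` has eigenvalue in `ℕ` under `d`, the nonpositive part of the triangular
decomposition lies in nonpositive degree. -/
theorem exists_nonpos_add_pos (d : G.H) (hd : ∀ i, G.root i d ∈ upC 0) (x : g) :
    ∃ a ∈ grd (d : g) dnC, ∃ b ∈ nP G Set.univ, x = a + b := by
  obtain ⟨a, ha, h, hh, b, hb, rfl⟩ := exists_triangular (G := G) x
  refine ⟨a + h, Submodule.add_mem _ ?_ ?_, b, hb, rfl⟩
  · refine nP_le_grd (G := flipKM G) d add_mem_dnC (fun i _ => ?_) ha
    obtain ⟨k, -, hk⟩ := hd i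
    exact ⟨k, by rw [← hk]; rfl⟩
  · refine grd_mono _ ?_ (cartan_le_grd d hh)
    rintro _ rfl
    exact ⟨0, by simp⟩

theorem wtSpace_two_root (s : I) : wtSpaceι G.H.subtype (G.root s + G.root s) = ⊥ := by
  obtain ⟨d, hd⟩ := exists_root_eq (G := G) fun t => if t = s then 1 else 3
  rw [Submodule.eq_bot_iff]
  intro x hx
  have hxd : ⁅(d : g), x⁆ = ((2 : ℕ) : ℂ) • x := by
    have := hx d
    rw [Submodule.subtype_apply, LinearMap.add_apply, hd, if_pos rfl] at this
    rw [this]; norm_num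
  obtain ⟨a, ha, b, hb, hab⟩ := exists_nonpos_add_pos (G := G) d (fun i => by
    rw [hd]
    split_ifs
    · exact ⟨1, by omega, by simp⟩
    · exact ⟨3, by omega, by simp⟩) x
  have hb' : b ∈ Submodule.span ℂ {G.e s} ⊔ grd (d : g) (upC 3) := by
    have hpos {y : g} (hy : y ∈ Submodule.span ℂ {G.e s} ⊔ grd (d : g) (upC 3)) :
        y ∈ grd (d : g) (upC 0) := by
      refine (show _ ≤ grd (d : g) (upC 0) from sup_le ?_ ?_) hy
      · rw [Submodule.span_singleton_le_iff_mem]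
        exact mem_grd (c := 1) ⟨1, by omega, by simp⟩ (by rw [G.lie_e d s, hd, if_pos rfl])
      · exact grd_mono _ fun c ⟨k, _, h⟩ => ⟨k, by omega, h⟩
    refine lieSpan_le_submodule ?_ ?_ hb
    · rintro _ ⟨t, -, rfl⟩
      by_cases hts : t = s
      · subst hts
        exact Submodule.mem_sup_left (Submodule.mem_span_singleton_self _)
      · refine Submodule.mem_sup_right (mem_grd ⟨3, le_rfl, by simp⟩ (c := 3) ?_)
        rw [G.lie_e d t, hd, if_neg hts]
    · intro x hx y hy
      refine Submodule.mem_sup_right ?_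
      obtain ⟨x₁, hx₁, x₂, hx₂, rfl⟩ := Submodule.mem_sup.1 hx
      have hy' := hpos hy
      rw [add_lie]
      refine Submodule.add_mem _ ?_ (lie_mem_grd (add_mem_upC (by omega)) hx₂ hy')
      obtain ⟨y₁, hy₁, y₂, hy₂, rfl⟩ := Submodule.mem_sup.1 hy
      have hx₁' := hpos (Submodule.mem_sup_left hx₁)
      rw [lie_add]
      refine Submodule.add_mem _ ?_ (lie_mem_grd (add_mem_upC (by omega)) hx₁' hy₂)
      obtain ⟨p, rfl⟩ := Submodule.mem_span_singleton.1 hx₁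
      obtain ⟨q, rfl⟩ := Submodule.mem_span_singleton.1 hy₁
      rw [smul_lie, lie_smul, lie_self, smul_zero, smul_zero]
      exact Submodule.zero_mem _
  refine eq_zero_of_mem_grd (s := {2}) (t := dnC ∪ {1} ∪ upC 3) ?_ (mem_grd rfl hxd) ?_
  · rw [Set.disjoint_singleton_left]
    rintro ((⟨k, hk⟩ | hk) | ⟨k, hk3, hk⟩)
    · have : ((2 + k : ℕ) : ℂ) = 0 := by push_cast; linear_combination hk
      have := Nat.cast_eq_zero.1 this
      omega
    · norm_num at hk
    · have : 2 = k := by exact_mod_cast hk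
      omega
  · rw [hab]
    refine Submodule.add_mem _ (grd_mono _ (fun c hc => Or.inl (Or.inl hc)) ha) ?_
    refine (show _ ≤ grd (d : g) (dnC ∪ {1} ∪ upC 3) from
      sup_le ?_ (grd_mono _ fun c hc => Or.inr hc)) hb'
    rw [Submodule.span_singleton_le_iff_mem]
    exact mem_grd (c := 1) (Or.inl (Or.inr rfl)) (by rw [G.lie_e d s, hd, if_pos rfl])

end KacMoody

end KMG
namespace KMG

open Module

theorem exists_trace_eq_natCast {W : Type*} [AddCommGroup W] [Module ℂ W]
    [FiniteDimensional ℂ W] {T : End ℂ W} (hT : ⨆ n : ℕ, T.eigenspace (n : ℂ) = ⊤)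
    {w : W} (hw : w ≠ 0) (hTw : T w = w) : ∃ n : ℕ, 0 < n ∧ LinearMap.trace ℂ W T = n := by
  have hroots : ∀ μ ∈ T.charpoly.roots, ∃ n : ℕ, (n : ℂ) = μ := by
    intro μ hμ
    by_contra hn
    push Not at hn
    have hev : T.HasEigenvalue μ :=
      (End.hasEigenvalue_iff_isRoot_charpoly T μ).2 (Polynomial.isRoot_of_mem_roots hμ)
    have hdis := T.eigenspaces_iSupIndep.disjoint_biSup (x := μ)
      (y := Set.range ((↑) : ℕ → ℂ)) (by rintro ⟨n, hn'⟩; exact hn n hn')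
    rw [iSup_range, hT, disjoint_top] at hdis
    exact hev hdis
  obtain ⟨t, ht⟩ : ∃ t : Multiset ℕ, t.map ((↑) : ℕ → ℂ) = T.charpoly.roots := by
    choose! c hc using hroots
    refine ⟨T.charpoly.roots.map c, ?_⟩
    rw [Multiset.map_map]
    exact (Multiset.map_congr rfl hc).trans (Multiset.map_id _)
  refine ⟨t.sum, ?_, ?_⟩
  · have h1 : (1 : ℂ) ∈ T.charpoly.roots := by
      rw [Polynomial.mem_roots (LinearMap.charpoly_monic T).ne_zero,
        ← End.hasEigenvalue_iff_isRoot_charpoly]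
      exact End.hasEigenvalue_of_hasEigenvector
        ⟨End.mem_eigenspace_iff.2 (by rw [hTw, one_smul]), hw⟩
    rw [← ht] at h1
    obtain ⟨n, hn, hn1⟩ := Multiset.mem_map.1 h1
    have : n = 1 := by exact_mod_cast hn1
    subst this
    exact Multiset.le_sum_of_mem hn
  · rw [End.trace_eq_sum_roots_charpoly_of_splits (IsAlgClosed.splits _), ← ht,
      Nat.cast_multiset_sum]

section KacMoody

variable {I : Type*} [Fintype I] [DecidableEq I] {A : Matrix I I ℤ}
variable {g : Type*} [LieRing g] [LieAlgebra ℂ g]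

/-- The action of `h ∈ H` on the subalgebra generated by the `e i`, `i ∈ T`. -/
def adP (G : KacMoodyAlgebra A g) (T : Set I) (h : G.H) : End ℂ (nP G T).toSubmodule :=
  (LieAlgebra.ad ℂ g (h : g)).restrict fun _ hx => lie_nP_mem h.2 hx

variable {G : KacMoodyAlgebra A g}

theorem iSup_eigenspace_adP {T : Set I} {d : G.H} (hd : ∀ i ∈ T, ∃ n : ℕ, G.root i d = n) :
    ⨆ n : ℕ, (adP G T d).eigenspace (n : ℂ) = ⊤ := by
  have key {x : g} (hx : x ∈ nP G T) :
      x ∈ Submodule.span ℂ {x | x ∈ nP G T ∧ ∃ n : ℕ, ⁅(d : g), x⁆ = (n : ℂ) • x} := by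
    refine lieSpan_le_submodule ?_ ?_ hx
    · rintro _ ⟨i, hi, rfl⟩
      obtain ⟨n, hn⟩ := hd i hi
      exact Submodule.subset_span ⟨e_mem_nP hi, n, by rw [G.lie_e, hn]⟩
    · intro x hx y hy
      induction hx using Submodule.span_induction with
      | zero => rw [zero_lie]; exact Submodule.zero_mem _
      | add a b _ _ ha hb => rw [add_lie]; exact Submodule.add_mem _ ha hb
      | smul c a _ ha => rw [smul_lie]; exact Submodule.smul_mem _ c ha
      | mem x hx =>
        obtain ⟨hx, p, hp⟩ := hx
        induction hy using Submodule.span_induction with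
        | zero => rw [lie_zero]; exact Submodule.zero_mem _
        | add a b _ _ ha hb => rw [lie_add]; exact Submodule.add_mem _ ha hb
        | smul c a _ ha => rw [lie_smul]; exact Submodule.smul_mem _ c ha
        | mem y hy =>
          obtain ⟨hy, q, hq⟩ := hy
          refine Submodule.subset_span ⟨(nP G T).lie_mem hx hy, p + q, ?_⟩
          rw [leibniz_lie, hp, hq, smul_lie, lie_smul, Nat.cast_add, add_smul]
  rw [eq_top_iff]
  have hle : (nP G T).toSubmodule ≤
      (⨆ n : ℕ, (adP G T d).eigenspace (n : ℂ)).map (nP G T).toSubmodule.subtype := by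
    intro x hx
    refine Submodule.span_le.2 ?_ (key hx)
    rintro y ⟨hy, n, hn⟩
    exact ⟨⟨y, hy⟩, Submodule.mem_iSup_of_mem n
      (End.mem_eigenspace_iff.2 (Subtype.ext hn)), rfl⟩
  rintro ⟨x, hx⟩ -
  obtain ⟨y, hy, hyx⟩ := hle hx
  rwa [show (⟨x, hx⟩ : (nP G T).toSubmodule) = y from Subtype.ext hyx.symm]

theorem coroot_notMem_nP {T : Set I} (i : I) : (G.coroot i : g) ∉ nP G T := by
  intro h
  obtain ⟨d, hd⟩ := exists_root_eq (G := G) fun _ => 1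
  refine G.indepCoroot.ne_zero i (Subtype.ext (eq_zero_of_mem_grd (s := {0}) (t := upC 1)
    ?_ (cartan_le_grd d (G.coroot i).2) (nP_le_grd d (add_mem_upC (by omega)) (fun j _ => ?_) h)))
  · rw [Set.disjoint_singleton_left]
    rintro ⟨k, hk, h0⟩
    have : 0 = k := by exact_mod_cast h0
    omega
  · rw [hd]; exact ⟨1, le_rfl, by simp⟩

theorem trace_adP_coroot (hA : IsGCM A) {T : Set I} [FiniteDimensional ℂ (nP G T).toSubmodule]
    {i : I} (hi : i ∈ T) : LinearMap.trace ℂ _ (adP G T (G.coroot i)) = 2 := by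
  obtain ⟨l, hl, hlW⟩ := LinearMap.exists_extend_of_notMem
    (0 : (nP G T).toSubmodule →ₗ[ℂ] ℂ) (coroot_notMem_nP (G := G) (T := T) i) 1
  have hl0 {x : g} (hx : x ∈ nP G T) : l x = 0 := LinearMap.congr_fun hl ⟨x, hx⟩
  set c : g := (G.coroot i : g) with hc
  let F₀ : End ℂ g := LieAlgebra.ad ℂ g (G.f i) - (l ∘ₗ LieAlgebra.ad ℂ g (G.f i)).smulRight c
  have hF₀ (x : g) : F₀ x = ⁅G.f i, x⁆ - l ⁅G.f i, x⁆ • c := rfl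
  have hF₀W : ∀ x ∈ (nP G T).toSubmodule, F₀ x ∈ (nP G T).toSubmodule := by
    intro x hx
    have := lie_f_nP_mem (K := Submodule.span ℂ {c}) (i := i) (by
      rw [Submodule.span_singleton_le_iff_mem]; exact (G.coroot i).2)
      (Submodule.mem_span_singleton_self c) hx
    obtain ⟨a, ha, b, hb, hab⟩ := Submodule.mem_sup.1 this
    obtain ⟨p, rfl⟩ := Submodule.mem_span_singleton.1 hb
    rw [hF₀, ← hab, map_add, hl0 ha, map_smul, hlW, smul_eq_mul, mul_one, zero_add,
      add_sub_cancel_right]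
    exact ha
  let E : End ℂ (nP G T).toSubmodule :=
    (LieAlgebra.ad ℂ g (G.e i)).restrict fun x hx => (nP G T).lie_mem (e_mem_nP hi) hx
  let F : End ℂ (nP G T).toSubmodule := F₀.restrict hF₀W
  let ei : (nP G T).toSubmodule := ⟨G.e i, e_mem_nP hi⟩
  let r : (nP G T).toSubmodule →ₗ[ℂ] ℂ :=
    (2 : ℂ) • (l ∘ₗ LieAlgebra.ad ℂ g (G.f i) ∘ₗ (nP G T).toSubmodule.subtype)
  have hcomm : E * F - F * E = adP G T (G.coroot i) + r.smulRight ei := by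
    refine LinearMap.ext fun x => Subtype.ext ?_
    obtain ⟨x, hx⟩ := x
    change ⁅G.e i, F₀ x⁆ - F₀ ⁅G.e i, x⁆ = ⁅c, x⁆ + ((2 : ℂ) * l ⁅G.f i, x⁆) • G.e i
    have h1 : ⁅G.f i, ⁅G.e i, x⁆⁆ =
        -⁅c, x⁆ + ⁅G.e i, F₀ x⁆ - ((2 : ℂ) * l ⁅G.f i, x⁆) • G.e i := by
      rw [leibniz_lie, lie_f_e_self, neg_lie, hF₀, lie_sub, lie_smul,
        ← lie_skew (G.e i) c, lie_coroot_e hA]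
      module
    have h2 : l ⁅G.f i, ⁅G.e i, x⁆⁆ = 0 := by
      refine hl0 ?_
      rw [h1]
      exact (nP G T).sub_mem ((nP G T).add_mem ((nP G T).neg_mem (lie_nP_mem (G.coroot i).2 hx))
        ((nP G T).lie_mem (e_mem_nP hi) (hF₀W x hx))) ((nP G T).smul_mem _ (e_mem_nP hi))
    rw [hF₀ ⁅G.e i, x⁆, h2, h1]
    module
  have htr := congrArg (LinearMap.trace ℂ _) hcomm
  rw [map_sub, LinearMap.trace_mul_comm, sub_self, map_add, LinearMap.trace_smulRight] at htr
  have hr : r ei = -2 := by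
    change (2 : ℂ) * l ⁅G.f i, G.e i⁆ = -2
    rw [lie_f_e_self, map_neg, ← hc, hlW]
    norm_num
  rw [hr] at htr
  linear_combination -htr

theorem isFiniteType_of_finiteDimensional (hA : IsGCM A) {T : Set I}
    (hfin : FiniteDimensional ℂ (nP G T).toSubmodule) : IsFiniteType (restrictM A T) := by
  have hdual : ∀ j : I, ∃ d : G.H, ∀ i, G.root i d = if i = j then 1 else 0 :=
    fun j => exists_root_eq _
  choose d hd using hdual
  have hu : ∀ j : T, ∃ n : ℕ, 0 < n ∧ LinearMap.trace ℂ _ (adP G T (d j)) = n := by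
    intro j
    refine exists_trace_eq_natCast (iSup_eigenspace_adP fun i _ => ?_)
      (w := ⟨G.e j, e_mem_nP j.2⟩) ?_ ?_
    · rw [hd]
      split_ifs
      · exact ⟨1, by simp⟩
      · exact ⟨0, by simp⟩
    · exact fun h => e_ne_zero (G := G) j.1 (congrArg Subtype.val h)
    · refine Subtype.ext ?_
      change ⁅(d j : g), G.e j⁆ = G.e j
      rw [G.lie_e, hd, if_pos rfl, one_smul]
  choose u hu0 hu using hu
  refine ⟨fun j => u j, fun j => Nat.cast_pos.2 (hu0 j), fun i => ?_⟩
  have hsum : adP G T (G.coroot i) = ∑ j : T, (A i j : ℂ) • adP G T (d j) := by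
    refine LinearMap.ext fun x => Subtype.ext ?_
    obtain ⟨x, hx⟩ := x
    have hy : ⁅((G.coroot i - ∑ j : T, (A i j : ℂ) • d j : G.H) : g), x⁆ = 0 := by
      refine lie_eq_zero_of_lieSpan ?_ hx
      rintro _ ⟨k, hk, rfl⟩
      rw [G.lie_e, map_sub, G.pairing, map_sum,
        Finset.sum_eq_single (⟨k, hk⟩ : T), map_smul, hd, if_pos rfl]
      · simp
      · intro j _ hj
        rw [map_smul, hd, if_neg (fun h => hj (Subtype.ext h.symm)), smul_zero]
      · simp
    rw [Submodule.coe_sub, sub_lie, sub_eq_zero] at hy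
    change ⁅(G.coroot i : g), x⁆ = _
    rw [hy]
    simp [LinearMap.sum_apply, adP, sum_lie]
    rfl
  have htr := trace_adP_coroot (G := G) hA i.2
  rw [hsum, map_sum] at htr
  simp only [map_smul, hu, smul_eq_mul] at htr
  have : ∑ j : T, (A i j : ℚ) * u j = 2 := by exact_mod_cast htr
  rw [finsum_eq_sum_of_fintype]
  change 0 < ∑ j : T, (A i j : ℚ) * u j
  rw [this]
  norm_num

end KacMoody

end KMG
namespace KMG

open Module

section Components

variable {I : Type*} {A : Matrix I I ℤ}

theorem self_mem_cmpnt {T : Set I} {k : I} (hk : k ∈ T) : k ∈ cmpnt A T k :=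
  ⟨hk, Relation.ReflTransGen.refl⟩

theorem mem_cmpnt_of_ne_zero {T : Set I} {k i j : I} (hi : i ∈ cmpnt A T k) (hj : j ∈ T)
    (h : A i j ≠ 0) : j ∈ cmpnt A T k :=
  ⟨hj, hi.2.tail ⟨hi.1, hj, h⟩⟩

theorem reflTransGen_symm (hA : IsGCM A) {T : Set I} {i j : I}
    (h : Relation.ReflTransGen (fun x y => x ∈ T ∧ y ∈ T ∧ A x y ≠ 0) i j) :
    Relation.ReflTransGen (fun x y => x ∈ T ∧ y ∈ T ∧ A x y ≠ 0) j i := by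
  have : Std.Symm fun x y => x ∈ T ∧ y ∈ T ∧ A x y ≠ 0 :=
    ⟨fun _ _ ⟨h₁, h₂, h₃⟩ => ⟨h₂, h₁, fun h => h₃ (hA.2.2 _ _ h)⟩⟩
  exact symm_of _ h

theorem cmpnt_mono {T U : Set I} (h : T ⊆ U) (k : I) : cmpnt A T k ⊆ cmpnt A U k :=
  fun _ ⟨hi, hk⟩ =>
    ⟨h hi, Relation.ReflTransGen.mono (fun _ _ ⟨h₁, h₂, h₃⟩ => ⟨h h₁, h h₂, h₃⟩) _ _ hk⟩

end Components

theorem lie_mem_of_mem_sup₃ {L : Type*} [LieRing L] [LieAlgebra ℂ L] {P Q R N : Submodule ℂ L}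
    (hPP : ∀ x ∈ P, ∀ y ∈ P, ⁅x, y⁆ ∈ N) (hPQ : ∀ x ∈ P, ∀ y ∈ Q, ⁅x, y⁆ ∈ N)
    (hPR : ∀ x ∈ P, ∀ y ∈ R, ⁅x, y⁆ ∈ N) (hQQ : ∀ x ∈ Q, ∀ y ∈ Q, ⁅x, y⁆ ∈ N)
    (hQR : ∀ x ∈ Q, ∀ y ∈ R, ⁅x, y⁆ ∈ N) (hRR : ∀ x ∈ R, ∀ y ∈ R, ⁅x, y⁆ ∈ N) :
    ∀ x ∈ P ⊔ Q ⊔ R, ∀ y ∈ P ⊔ Q ⊔ R, ⁅x, y⁆ ∈ N := by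
  intro x hx y hy
  obtain ⟨x', hx', c, hc, rfl⟩ := Submodule.mem_sup.1 hx
  obtain ⟨a, ha, b, hb, rfl⟩ := Submodule.mem_sup.1 hx'
  obtain ⟨y', hy', c', hc', rfl⟩ := Submodule.mem_sup.1 hy
  obtain ⟨a', ha', b', hb', rfl⟩ := Submodule.mem_sup.1 hy'
  have hsk {u v : L} (h : ⁅v, u⁆ ∈ N) : ⁅u, v⁆ ∈ N := by
    rw [← lie_skew]; exact N.neg_mem h
  simp only [lie_add, add_lie]
  exact N.add_mem (N.add_mem
    (N.add_mem (N.add_mem (hPP _ ha _ ha') (hsk (hPQ _ ha' _ hb)))  (hsk (hPR _ ha' _ hc)))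
    (N.add_mem (N.add_mem (hPQ _ ha _ hb') (hQQ _ hb _ hb')) (hsk (hQR _ hb' _ hc))))
    (N.add_mem (N.add_mem (hPR _ ha _ hc') (hQR _ hb _ hc')) (hRR _ hc _ hc'))

section KacMoody

variable {I : Type*} [Fintype I] [DecidableEq I] {A : Matrix I I ℤ}
variable {g : Type*} [LieRing g] [LieAlgebra ℂ g] {G : KacMoodyAlgebra A g}

theorem lie_e_e_of_eq_zero {i j : I} (hij : i ≠ j) (h : A i j = 0) : ⁅G.e i, G.e j⁆ = 0 := by
  have := G.serre_e i j hij
  rw [h] at this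
  simpa using this

theorem lie_e_gS_eq_zero {T : Set I} {j : I} (h : ∀ i ∈ T, j ≠ i ∧ A j i = 0) {x : g}
    (hx : x ∈ gS G T) : ⁅G.e j, x⁆ = 0 := by
  refine lie_eq_zero_of_lieSpan ?_ hx
  rintro _ (⟨i, hi, rfl⟩ | ⟨i, hi, rfl⟩)
  · exact lie_e_e_of_eq_zero (h i hi).1 (h i hi).2
  · exact lie_e_f_ne (h i hi).1

theorem lie_gS_gS_eq_zero {T U : Set I} (h : ∀ i ∈ T, ∀ j ∈ U, i ≠ j ∧ A i j = 0) {x y : g}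
    (hx : x ∈ gS G T) (hy : y ∈ gS G U) : ⁅x, y⁆ = 0 := by
  rw [← lie_skew, neg_eq_zero]
  refine lie_eq_zero_of_lieSpan ?_ hx
  rintro _ (⟨i, hi, rfl⟩ | ⟨i, hi, rfl⟩)
  · rw [← lie_skew, lie_e_gS_eq_zero (h i hi) hy, neg_zero]
  · rw [← gS_flip] at hy
    rw [← lie_skew, neg_eq_zero]
    exact lie_e_gS_eq_zero (G := flipKM G) (h i hi) hy

theorem form_eq_zero_of_commute (hA : IsGCM A) {Bf : g →ₗ[ℂ] g →ₗ[ℂ] ℂ}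
    (hBf : ∀ x y z, Bf ⁅x, y⁆ z = Bf x ⁅y, z⁆) {T : Set I} {y : g}
    (hy : ∀ x ∈ gS G T, ⁅x, y⁆ = 0) {x : g} (hx : x ∈ gS G T) : Bf x y = 0 := by
  have key := hx
  unfold gS at key
  induction key using LieSubalgebra.lieSpan_induction with
  | mem z hz =>
    rcases hz with ⟨i, hi, rfl⟩ | ⟨i, hi, rfl⟩
    · have h := hBf (G.coroot i) (G.e i) y
      rw [hy _ hx, map_zero, lie_coroot_e hA, map_smul, LinearMap.smul_apply,
        smul_eq_mul] at h
      exact (mul_eq_zero.1 h).resolve_left two_ne_zero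
    · have h := hBf ((flipKM G).coroot i) ((flipKM G).e i) y
      rw [lie_coroot_e hA, map_smul, LinearMap.smul_apply, smul_eq_mul] at h
      change 2 * Bf (G.f i) y = Bf _ ⁅G.f i, y⁆ at h
      rw [hy _ hx, map_zero] at h
      exact (mul_eq_zero.1 h).resolve_left two_ne_zero
  | zero => rw [map_zero, LinearMap.zero_apply]
  | add a b ha' hb' ha hb => rw [map_add, LinearMap.add_apply, ha ha', hb hb', add_zero]
  | smul c a ha' ha => rw [map_smul, LinearMap.smul_apply, ha ha', smul_zero]
  | lie a b ha' hb' ha hb => rw [hBf, hy b hb', map_zero]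

theorem lie_gS_mem {T : Set I} (h : G.H) {x : g} (hx : x ∈ gS G T) : ⁅(h : g), x⁆ ∈ gS G T := by
  unfold gS at hx
  induction hx using LieSubalgebra.lieSpan_induction with
  | mem x hx =>
    rcases hx with ⟨i, hi, rfl⟩ | ⟨i, hi, rfl⟩
    · rw [G.lie_e h i]; exact (gS G T).smul_mem _ (e_mem_gS hi)
    · rw [G.lie_f h i]; exact (gS G T).smul_mem _ (f_mem_gS hi)
  | zero => rw [lie_zero]; exact (gS G T).zero_mem
  | add a b _ _ ha hb => rw [lie_add]; exact (gS G T).add_mem ha hb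
  | smul c a _ ha => rw [lie_smul]; exact (gS G T).smul_mem c ha
  | lie a b ha' hb' ha hb =>
    rw [leibniz_lie]
    exact (gS G T).add_mem ((gS G T).lie_mem ha hb') ((gS G T).lie_mem ha' hb)

theorem lie_gS_eq_zero_of_root {T : Set I} {h : G.H} (hh : ∀ i ∈ T, G.root i h = 0) {x : g}
    (hx : x ∈ gS G T) : ⁅(h : g), x⁆ = 0 := by
  refine lie_eq_zero_of_lieSpan ?_ hx
  rintro _ (⟨i, hi, rfl⟩ | ⟨i, hi, rfl⟩)
  · rw [G.lie_e, hh i hi, zero_smul]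
  · rw [G.lie_f, hh i hi, neg_zero, zero_smul]

theorem derivedSeries_one_le_gS {x : g} (hx : x ∈ LieAlgebra.derivedSeries ℂ g 1) :
    x ∈ gS G Set.univ := by
  have hdec (x : g) : ∃ h : G.H, ∃ a ∈ gS G Set.univ, x = h + a := by
    obtain ⟨a, ha, h, hh, b, hb, rfl⟩ := exists_triangular (G := G) x
    refine ⟨⟨h, hh⟩, a + b, (gS G Set.univ).add_mem ?_ (nP_le_gS _ hb), by rw [add_left_comm]; abel⟩
    rw [← gS_flip]
    exact nP_le_gS _ ha
  rw [LieAlgebra.derivedSeries_def, LieAlgebra.derivedSeriesOfIdeal_succ,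
    LieAlgebra.derivedSeriesOfIdeal_zero, ← LieSubmodule.mem_toSubmodule,
    LieSubmodule.lieIdeal_oper_eq_linear_span'] at hx
  refine (Submodule.span_le (p := (gS G Set.univ).toSubmodule)).2 ?_ hx
  rintro _ ⟨x, -, y, -, rfl⟩
  obtain ⟨h, a, ha, rfl⟩ := hdec x
  obtain ⟨h', a', ha', rfl⟩ := hdec y
  rw [lie_add, add_lie, add_lie, G.abelian, zero_add, ← lie_skew a]
  exact (gS G Set.univ).add_mem ((gS G Set.univ).neg_mem (lie_gS_mem h' ha))
    ((gS G Set.univ).add_mem (lie_gS_mem h ha') ((gS G Set.univ).lie_mem ha ha'))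

/-- Along a path in the Dynkin diagram one finds a root which is a sum of distinct simple roots,
among which the two end points. -/
theorem exists_ne_zero_of_reflTransGen (hA : IsGCM A) {T : Set I} {k i : I} (hk : k ∈ T)
    (h : Relation.ReflTransGen (fun x y => x ∈ T ∧ y ∈ T ∧ A x y ≠ 0) k i) :
    ∃ s : Finset I, k ∈ s ∧ i ∈ s ∧ (∀ t ∈ s, t ∈ T) ∧
      ∃ x : g, x ≠ 0 ∧ x ∈ nP G (s : Set I) ∧
        ∀ h : G.H, ⁅(h : g), x⁆ = (∑ t ∈ s, G.root t h) • x := by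
  induction h with
  | refl =>
    refine ⟨{k}, by simp, by simp, by simpa using hk, G.e k, e_ne_zero k,
      e_mem_nP (by simp), fun h => ?_⟩
    rw [Finset.sum_singleton, G.lie_e]
  | @tail a b _ hab ih =>
    obtain ⟨s, hks, has, hsT, x, hx0, hxs, hx⟩ := ih
    by_cases hb : b ∈ s
    · exact ⟨s, hks, hb, hsT, x, hx0, hxs, hx⟩
    have hsub : (s : Set I) ⊆ ((insert b s : Finset I) : Set I) := by simp
    refine ⟨insert b s, Finset.mem_insert_of_mem hks, Finset.mem_insert_self b s, ?_,
      ⁅G.e b, x⁆, ?_, (nP G _).lie_mem (e_mem_nP (by simp)) (nP_mono hsub hxs), fun h => ?_⟩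
    · intro t ht
      rcases Finset.mem_insert.1 ht with rfl | ht
      · exact hab.2.1
      · exact hsT t ht
    · intro h0
      have hfx : ⁅G.f b, x⁆ = 0 := by
        refine lie_eq_zero_of_lieSpan ?_ hxs
        rintro _ ⟨j, hj, rfl⟩
        exact lie_f_e_ne fun h => hb (h ▸ hj)
      have h1 : ⁅G.f b, ⁅G.e b, x⁆⁆ = -((∑ t ∈ s, G.root t (G.coroot b)) • x) := by
        rw [leibniz_lie, hfx, lie_zero, add_zero, lie_f_e_self, neg_lie, hx]
      rw [h0, lie_zero, zero_eq_neg, smul_eq_zero, or_iff_left hx0] at h1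
      simp only [G.pairing] at h1
      have h2 : ∑ t ∈ s, A b t = 0 := by exact_mod_cast h1
      have h3 : ∑ t ∈ s, A b t < 0 := by
        refine Finset.sum_neg' (fun t ht => hA.2.1 b t fun h => hb (h ▸ ht)) ⟨a, has, ?_⟩
        refine lt_of_le_of_ne (hA.2.1 b a fun h => hb (h ▸ has)) fun h => hab.2.2 (hA.2.2 _ _ h)
      omega
    · rw [leibniz_lie, G.lie_e, hx, smul_lie, lie_smul, Finset.sum_insert hb, add_smul]

end KacMoody

end KMG
namespace KMG

open Module

theorem lie_mem_eigenspace_ad {L : Type*} [LieRing L] [LieAlgebra ℂ L] {h x y : L} {a b : ℂ}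
    (hx : x ∈ End.eigenspace (LieAlgebra.ad ℂ L h) a)
    (hy : y ∈ End.eigenspace (LieAlgebra.ad ℂ L h) b) :
    ⁅x, y⁆ ∈ End.eigenspace (LieAlgebra.ad ℂ L h) (a + b) := by
  rw [End.mem_eigenspace_iff, LieAlgebra.ad_apply] at *
  rw [leibniz_lie, hx, hy, smul_lie, lie_smul, add_smul]

section Grading

variable {I : Type*} [Fintype I] [DecidableEq I] {A : Matrix I I ℤ}
variable {g : Type*} [LieRing g] [LieAlgebra ℂ g] {G : KacMoodyAlgebra A g}
variable {S : Type*} [Fintype S] [DecidableEq S] {B : Matrix S S ℤ}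
variable {m : Type*} [LieRing m] [LieAlgebra ℂ m] {M : KacMoodyAlgebra B m} {φ : m →ₗ⁅ℂ⁆ g}

variable (M φ) in
/-- The weight space `V_χ` of `g` for the Cartan subalgebra of the grading subalgebra. -/
abbrev grV (χ : Dual ℂ M.H) : Submodule ℂ g := wtSpaceι (φ.toLinearMap ∘ₗ M.H.subtype) χ

theorem map_mem_grV {χ : Dual ℂ M.H} {x : m} (hx : x ∈ wtSpaceι M.H.subtype χ) :
    φ x ∈ grV M φ χ := fun v => by
  change ⁅φ v, φ x⁆ = _
  rw [← LieHom.map_lie, show ⁅(v : m), x⁆ = χ v • x from hx v, map_smul]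

theorem e_mem_grV (hle : M.H.map φ.toLinearMap ≤ G.H) (i : I) :
    G.e i ∈ grV M φ (resRoot G M φ hle i) :=
  fun v => G.lie_e (cartanIncl G M φ hle v) i

theorem f_mem_grV (hle : M.H.map φ.toLinearMap ≤ G.H) (i : I) :
    G.f i ∈ grV M φ (-resRoot G M φ hle i) :=
  fun v => G.lie_f (cartanIncl G M φ hle v) i

theorem grV_eq_bot (hgr : IsFinGrading M φ) {χ : Dual ℂ M.H} (h0 : χ ≠ 0)
    (hχ : wtSpaceι M.H.subtype χ = ⊥) : grV M φ χ = ⊥ := by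
  refine wtSpace_eq_bot (fun v w => ?_) hgr.2.1 ?_
  · change ⁅φ v, φ w⁆ = 0
    rw [← LieHom.map_lie, M.abelian, map_zero]
  · rintro (h | h)
    · exact h0 h
    · exact h.2 hχ

theorem grV_two_root (hgr : IsFinGrading M φ) (s : S) :
    grV M φ (M.root s + M.root s) = ⊥ := by
  refine grV_eq_bot hgr (fun h => M.indepRoot.ne_zero s ?_) (wtSpace_two_root s)
  rw [← two_smul ℂ] at h
  exact (smul_eq_zero.1 h).resolve_left two_ne_zero

theorem grV_neg_two_root (hgr : IsFinGrading M φ) (s : S) :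
    grV M φ (-M.root s + -M.root s) = ⊥ :=
  grV_two_root (M := flipKM M) hgr s

theorem root_mem_Delta (s : S) : M.root s ∈ Delta M := by
  refine ⟨M.indepRoot.ne_zero s, fun h => e_ne_zero (G := M) s ?_⟩
  rw [Submodule.eq_bot_iff] at h
  exact h _ fun v => M.lie_e v s

theorem finiteDimensional_grV (hgr : IsFinGrading M φ) (s : S) :
    FiniteDimensional ℂ ↥(grV M φ 0 ⊔ grV M φ (M.root s) ⊔ grV M φ (-M.root s)) := by
  have h0 := hgr.2.2 0 (Set.mem_insert _ _)
  have h1 := hgr.2.2 _ (Set.mem_insert_of_mem _ (root_mem_Delta s))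
  have h2 := hgr.2.2 _ (Set.mem_insert_of_mem _ (root_mem_Delta (M := flipKM M) s))
  change FiniteDimensional ℂ (grV M φ (-M.root s)) at h2
  infer_instance

theorem gS_cmpnt_three_grading (hgr : IsFinGrading M φ) {hle : M.H.map φ.toLinearMap ≤ G.H}
    {s : S} {k : I} (hk : k ∈ GammaOf G M φ hle s) {T : Set I}
    (hT : ∀ i ∈ T, i ≠ k → i ∈ Jof G M φ hle) {h : G.H} (h2 : G.root k h = 2)
    (h0 : ∀ i ∈ T, i ≠ k → G.root i h = 0) {x : g} (hx : x ∈ gS G T) :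
    x ∈ (grV M φ 0 ⊓ End.eigenspace (LieAlgebra.ad ℂ g h) 0) ⊔
      (grV M φ (M.root s) ⊓ End.eigenspace (LieAlgebra.ad ℂ g h) 2) ⊔
      (grV M φ (-M.root s) ⊓ End.eigenspace (LieAlgebra.ad ℂ g h) (-2)) := by
  have hJ {i : I} (hi : i ∈ T) (hik : i ≠ k) : resRoot G M φ hle i = 0 := hT i hi hik
  have hk' : resRoot G M φ hle k = M.root s := hk
  refine lieSpan_le_submodule ?_ ?_ hx
  · rintro _ (⟨i, hi, rfl⟩ | ⟨i, hi, rfl⟩) <;> by_cases hik : i = k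
    · refine Submodule.mem_sup_left (Submodule.mem_sup_right ⟨?_, ?_⟩)
      · rw [hik, ← hk']; exact e_mem_grV hle k
      · rw [SetLike.mem_coe, End.mem_eigenspace_iff, LieAlgebra.ad_apply, G.lie_e, hik, h2]
    · refine Submodule.mem_sup_left (Submodule.mem_sup_left ⟨?_, ?_⟩)
      · have := e_mem_grV (G := G) hle i
        rwa [hJ hi hik] at this
      · rw [SetLike.mem_coe, End.mem_eigenspace_iff, LieAlgebra.ad_apply, G.lie_e, h0 i hi hik]
    · refine Submodule.mem_sup_right ⟨?_, ?_⟩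
      · rw [hik, ← hk']; exact f_mem_grV hle k
      · rw [SetLike.mem_coe, End.mem_eigenspace_iff, LieAlgebra.ad_apply, G.lie_f, hik, h2]
    · refine Submodule.mem_sup_left (Submodule.mem_sup_left ⟨?_, ?_⟩)
      · have := f_mem_grV (G := G) hle i
        rwa [hJ hi hik, neg_zero] at this
      · rw [SetLike.mem_coe, End.mem_eigenspace_iff, LieAlgebra.ad_apply, G.lie_f, h0 i hi hik,
          neg_zero]
  · have hb {χ ψ ω : Dual ℂ M.H} {a b c : ℂ} (hω : χ + ψ = ω) (hc : a + b = c) {x y : g}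
        (hx : x ∈ grV M φ χ ⊓ End.eigenspace (LieAlgebra.ad ℂ g h) a)
        (hy : y ∈ grV M φ ψ ⊓ End.eigenspace (LieAlgebra.ad ℂ g h) b) :
        ⁅x, y⁆ ∈ grV M φ ω ⊓ End.eigenspace (LieAlgebra.ad ℂ g h) c :=
      ⟨hω ▸ lie_mem_wtSpace hx.1 hy.1, hc ▸ lie_mem_eigenspace_ad hx.2 hy.2⟩
    refine lie_mem_of_mem_sup₃ ?_ ?_ ?_ ?_ ?_ ?_ <;> intro x hx y hy
    · exact Submodule.mem_sup_left (Submodule.mem_sup_left (hb (add_zero _) (add_zero _) hx hy))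
    · exact Submodule.mem_sup_left (Submodule.mem_sup_right (hb (zero_add _) (zero_add _) hx hy))
    · exact Submodule.mem_sup_right (hb (zero_add _) (zero_add _) hx hy)
    · have : ⁅x, y⁆ ∈ grV M φ (M.root s + M.root s) := lie_mem_wtSpace hx.1 hy.1
      rw [grV_two_root hgr, Submodule.mem_bot] at this
      rw [this]; exact Submodule.zero_mem _
    · exact Submodule.mem_sup_left (Submodule.mem_sup_left
        (hb (add_neg_cancel _) (add_neg_cancel _) hx hy))
    · have : ⁅x, y⁆ ∈ grV M φ (-M.root s + -M.root s) := lie_mem_wtSpace hx.1 hy.1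
      rw [grV_neg_two_root hgr, Submodule.mem_bot] at this
      rw [this]; exact Submodule.zero_mem _

theorem mem_Jof_of_mem_cmpnt {hle : M.H.map φ.toLinearMap ≤ G.H} {i k : I}
    (hi : i ∈ cmpnt A (Jof G M φ hle ∪ {k}) k) (hik : i ≠ k) : i ∈ Jof G M φ hle :=
  hi.1.resolve_right hik

theorem isFiniteType_cmpnt (hA : IsGCM A) (hB : IsGCM B) (hgr : IsFinGrading M φ)
    {hle : M.H.map φ.toLinearMap ≤ G.H} {s : S} {k : I} (hk : k ∈ GammaOf G M φ hle s) :
    IsFiniteType (restrictM A (cmpnt A (Jof G M φ hle ∪ {k}) k)) := by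
  refine isFiniteType_of_finiteDimensional (G := G) hA ?_
  have := finiteDimensional_grV hgr s
  refine Submodule.finiteDimensional_of_le (S₂ := grV M φ 0 ⊔ grV M φ (M.root s) ⊔
    grV M φ (-M.root s)) fun x hx => ?_
  have hroot (i : I) : G.root i (cartanIncl G M φ hle (M.coroot s)) =
      resRoot G M φ hle i (M.coroot s) := rfl
  refine (sup_le_sup (sup_le_sup inf_le_left inf_le_left) inf_le_left : (_ : Submodule ℂ g) ≤ _)
    (gS_cmpnt_three_grading hgr hk (h := cartanIncl G M φ hle (M.coroot s))
      (fun i hi hik => mem_Jof_of_mem_cmpnt hi hik) ?_ (fun i hi hik => ?_) (nP_le_gS _ hx))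
  · rw [hroot, show resRoot G M φ hle k = M.root s from hk, M.pairing, hB.1]
    norm_num
  · rw [hroot, show resRoot G M φ hle i = 0 from mem_Jof_of_mem_cmpnt hi hik]
    rfl

theorem ne_and_eq_zero_of_mem_cmpnt (hA : IsGCM A) (hgr : IsFinGrading M φ)
    {hle : M.H.map φ.toLinearMap ≤ G.H} {s : S} {k l : I} (hk : k ∈ GammaOf G M φ hle s)
    (hl : l ∈ GammaOf G M φ hle s) (hkl : k ≠ l) {i j : I}
    (hi : i ∈ cmpnt A (Jof G M φ hle ∪ {k}) k) (hj : j ∈ cmpnt A (Jof G M φ hle ∪ {l}) l) :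
    i ≠ j ∧ A i j = 0 := by
  by_contra hcon
  set T := Jof G M φ hle ∪ {k, l}
  have hi' : i ∈ cmpnt A T k := cmpnt_mono (Set.union_subset_union_right _ (by simp)) k hi
  have hj' : j ∈ cmpnt A T l := cmpnt_mono (Set.union_subset_union_right _ (by simp)) l hj
  have hij : Relation.ReflTransGen (fun x y => x ∈ T ∧ y ∈ T ∧ A x y ≠ 0) k j := by
    by_cases h : i = j
    · exact h ▸ hi'.2
    · exact hi'.2.tail ⟨hi'.1, hj'.1, fun h' => hcon ⟨h, h'⟩⟩
  obtain ⟨F, hkF, hlF, hFT, x, hx0, -, hx⟩ := exists_ne_zero_of_reflTransGen (G := G) hA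
    (Set.mem_union_right _ (by simp)) (hij.trans (reflTransGen_symm hA hj'.2))
  have hsum : ∑ t ∈ F, resRoot G M φ hle t = M.root s + M.root s := by
    have hsub : {k, l} ⊆ F := by
      rw [Finset.insert_subset_iff, Finset.singleton_subset_iff]; exact ⟨hkF, hlF⟩
    rw [← Finset.sum_subset hsub, Finset.sum_pair hkl, show resRoot G M φ hle k = M.root s from hk,
      show resRoot G M φ hle l = M.root s from hl]
    intro t ht htkl
    exact (hFT t ht).resolve_right fun h => htkl (by simpa using h)
  have hxV : x ∈ grV M φ (M.root s + M.root s) := fun v => by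
    rw [← hsum, LinearMap.sum_apply]
    exact hx (cartanIncl G M φ hle v)
  rw [grV_two_root hgr, Submodule.mem_bot] at hxV
  exact hx0 hxV

variable (G M φ) in
/-- Every simple root of `g` restricts to a nonnegative integral combination of simple roots of
the grading subalgebra. -/
def ResNonneg (hle : M.H.map φ.toLinearMap ≤ G.H) : Prop :=
  ∀ i, ∃ c : S → ℕ, resRoot G M φ hle i = ∑ t, (c t : ℂ) • M.root t

theorem Adapted.resNonneg {hle : M.H.map φ.toLinearMap ≤ G.H} (h : Adapted G M φ hle) :
    ResNonneg G M φ hle := fun i => by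
  have hi : G.root i ∈ posRoots G :=
    ⟨root_mem_Delta i, fun t => if t = i then 1 else 0, by simp⟩
  rcases h _ hi with h | ⟨-, c, h⟩
  · exact ⟨0, h.trans (by simp)⟩
  · exact ⟨c, h⟩

theorem resRoot_flip (hle : M.H.map φ.toLinearMap ≤ G.H) (i : I) :
    resRoot (flipKM G) (flipKM M) φ hle i = -resRoot G M φ hle i := rfl

theorem ResNonneg.flip {hle : M.H.map φ.toLinearMap ≤ G.H} (h : ResNonneg G M φ hle) :
    ResNonneg (flipKM G) (flipKM M) φ hle := fun i => by
  obtain ⟨c, hc⟩ := h i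
  refine ⟨c, ?_⟩
  rw [resRoot_flip, hc, ← Finset.sum_neg_distrib]
  exact Finset.sum_congr rfl fun t _ => (smul_neg _ _).symm

theorem Jof_flip (hle : M.H.map φ.toLinearMap ≤ G.H) :
    Jof (flipKM G) (flipKM M) φ hle = Jof G M φ hle :=
  Set.ext fun i => neg_eq_zero (a := resRoot G M φ hle i)

theorem GammaOf_flip (hle : M.H.map φ.toLinearMap ≤ G.H) (s : S) :
    GammaOf (flipKM G) (flipKM M) φ hle s = GammaOf G M φ hle s :=
  Set.ext fun i => neg_inj (a := resRoot G M φ hle i)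

theorem ResNonneg.trichotomy {hle : M.H.map φ.toLinearMap ≤ G.H} (h : ResNonneg G M φ hle) {s : S}
    {d : M.H} (hd : ∀ t, M.root t d = if t = s then 1 else 2) (i : I) :
    i ∈ Jof G M φ hle ∨ i ∈ GammaOf G M φ hle s ∨ resRoot G M φ hle i d ∈ upC 2 := by
  obtain ⟨c, hc⟩ := h i
  set n := ∑ t, c t * (if t = s then 1 else 2) with hn
  have hle' (t : S) : c t * (if t = s then 1 else 2) ≤ n :=
    Finset.single_le_sum (f := fun t => c t * (if t = s then 1 else 2))
      (fun _ _ => Nat.zero_le _) (Finset.mem_univ t)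
  by_cases hn2 : 2 ≤ n
  · refine Or.inr (Or.inr ⟨n, hn2, ?_⟩)
    rw [hc, LinearMap.sum_apply, hn, Nat.cast_sum]
    refine Finset.sum_congr rfl fun t _ => ?_
    rw [LinearMap.smul_apply, hd, smul_eq_mul]
    split_ifs <;> simp
  have hne (t : S) (hts : t ≠ s) : c t = 0 := by
    have := hle' t
    rw [if_neg hts] at this
    omega
  rw [Finset.sum_eq_single s (fun t _ hts => by rw [hne t hts, Nat.cast_zero, zero_smul])
    (fun h => absurd (Finset.mem_univ s) h)] at hc
  have hs : c s = 0 ∨ c s = 1 := by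
    have := hle' s
    rw [if_pos rfl] at this
    omega
  rcases hs with hs | hs
  · left
    rw [hs, Nat.cast_zero, zero_smul] at hc
    exact hc
  · right; left
    rw [hs, Nat.cast_one, one_smul] at hc
    exact hc

theorem lie_nP_Jof_mem (hA : IsGCM A) {hle : M.H.map φ.toLinearMap ≤ G.H} {χ : Dual ℂ M.H} {k : I}
    {x y : g} (hx : x ∈ nP G (Jof G M φ hle))
    (hy : y ∈ grV M φ χ ⊓ (gS G (cmpnt A (Jof G M φ hle ∪ {k}) k)).toSubmodule) :
    ⁅x, y⁆ ∈ grV M φ χ ⊓ (gS G (cmpnt A (Jof G M φ hle ∪ {k}) k)).toSubmodule := by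
  refine lieSpan_stabilizes ?_ hx y hy
  rintro _ ⟨j, hj, rfl⟩ y ⟨hy₁, hy₂⟩
  by_cases hjk : j ∈ cmpnt A (Jof G M φ hle ∪ {k}) k
  · refine ⟨?_, (gS G _).lie_mem (e_mem_gS hjk) hy₂⟩
    have := lie_mem_wtSpace (e_mem_grV (G := G) hle j) hy₁
    rwa [show resRoot G M φ hle j = 0 from hj, zero_add] at this
  · rw [lie_e_gS_eq_zero (fun i hi => ⟨fun h => hjk (by rwa [h]), ?_⟩) hy₂]
    · exact Submodule.zero_mem _
    · by_contra h
      exact hjk (mem_cmpnt_of_ne_zero hi (Or.inl hj) fun h' => h (hA.2.2 _ _ h'))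

theorem exists_map_e_eq_sum (hA : IsGCM A) {hle : M.H.map φ.toLinearMap ≤ G.H}
    (hρ : ResNonneg G M φ hle) (s : S) :
    ∃ E : I → g, (∀ k ∉ GammaOf G M φ hle s, E k = 0) ∧
      (∀ k ∈ GammaOf G M φ hle s, E k ∈ grV M φ (M.root s) ∧
        E k ∈ gS G (cmpnt A (Jof G M φ hle ∪ {k}) k)) ∧ φ (M.e s) = ∑ k, E k := by
  obtain ⟨d, hd⟩ := exists_root_eq (G := M) fun t => if t = s then 1 else 2
  have htri := hρ.trichotomy hd
  set D := cartanIncl G M φ hle d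
  have hroot (i : I) : G.root i D = resRoot G M φ hle i d := rfl
  let p (k : I) : Submodule ℂ g := ⨆ _ : k ∈ GammaOf G M φ hle s,
    grV M φ (M.root s) ⊓ (gS G (cmpnt A (Jof G M φ hle ∪ {k}) k)).toSubmodule
  have hp {k : I} (hk : k ∈ GammaOf G M φ hle s) : p k =
    grV M φ (M.root s) ⊓ (gS G (cmpnt A (Jof G M φ hle ∪ {k}) k)).toSubmodule := iSup_pos hk
  have hp' {k : I} (hk : k ∉ GammaOf G M φ hle s) : p k = ⊥ := iSup_neg hk
  have hV {x : g} (hx : x ∈ grV M φ (M.root s)) : x ∈ grd (D : g) {1} := by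
    have := hx d
    rw [hd, if_pos rfl] at this
    exact mem_grd rfl this
  have hP : iSup p ≤ grd (D : g) {1} :=
    iSup_le fun k => iSup_le fun _ => inf_le_left.trans fun x hx => hV hx
  have hP₀ {x : g} (hx : x ∈ nP G (Jof G M φ hle)) : x ∈ grd (D : g) {0} :=
    nP_le_grd D (by simp) (fun i hi => by
      rw [hroot, show resRoot G M φ hle i = 0 from hi]; rfl) hx
  have hP₀P {x y : g} (hx : x ∈ nP G (Jof G M φ hle)) (hy : y ∈ iSup p) : ⁅x, y⁆ ∈ iSup p := by
    refine Submodule.iSup_induction p (motive := fun y => ⁅x, y⁆ ∈ iSup p) hy (fun k y hy => ?_)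
      (by rw [lie_zero]; exact Submodule.zero_mem _)
      (fun y z hy hz => by rw [lie_add]; exact Submodule.add_mem _ hy hz)
    by_cases hk : k ∈ GammaOf G M φ hle s
    · refine Submodule.mem_iSup_of_mem k ?_
      rw [hp hk] at hy
      rw [iSup_pos hk]
      exact lie_nP_Jof_mem hA hx hy
    · rw [hp' hk, Submodule.mem_bot] at hy
      rw [hy, lie_zero]; exact Submodule.zero_mem _
  have hle3 {x : g} (hx : x ∈ nP G Set.univ) :
      x ∈ (nP G (Jof G M φ hle)).toSubmodule ⊔ iSup p ⊔ grd (D : g) (upC 2) := by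
    refine lieSpan_le_submodule ?_ ?_ hx
    · rintro _ ⟨i, -, rfl⟩
      rcases htri i with hi | hi | hi
      · exact Submodule.mem_sup_left (Submodule.mem_sup_left (e_mem_nP hi))
      · refine Submodule.mem_sup_left (Submodule.mem_sup_right (Submodule.mem_iSup_of_mem i ?_))
        rw [iSup_pos hi]
        refine ⟨?_, e_mem_gS (self_mem_cmpnt (Or.inr rfl))⟩
        have := e_mem_grV (G := G) hle i
        rwa [show resRoot G M φ hle i = M.root s from hi] at this
      · exact Submodule.mem_sup_right (mem_grd hi (G.lie_e D i))
    · have h0 : ∀ a ∈ ({0} : Set ℂ), ∀ b ∈ upC 2, a + b ∈ upC 2 := by simp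
      have h1 : ∀ a ∈ ({1} : Set ℂ), ∀ b ∈ ({1} : Set ℂ), a + b ∈ upC 2 := by
        rintro _ rfl _ rfl
        exact ⟨2, le_rfl, by norm_num⟩
      have h2 : ∀ a ∈ ({1} : Set ℂ), ∀ b ∈ upC 2, a + b ∈ upC 2 := by
        rintro _ rfl _ hb
        exact add_mem_upC (p := 1) (by omega) _ ⟨1, le_rfl, by simp⟩ _ hb
      refine lie_mem_of_mem_sup₃ ?_ ?_ ?_ ?_ ?_ ?_ <;> intro x hx y hy
      · exact Submodule.mem_sup_left (Submodule.mem_sup_left ((nP G _).lie_mem hx hy))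
      · exact Submodule.mem_sup_left (Submodule.mem_sup_right (hP₀P hx hy))
      · exact Submodule.mem_sup_right (lie_mem_grd h0 (hP₀ hx) hy)
      · exact Submodule.mem_sup_right (lie_mem_grd h1 (hP hx) (hP hy))
      · exact Submodule.mem_sup_right (lie_mem_grd h2 (hP hx) hy)
      · exact Submodule.mem_sup_right (lie_mem_grd (add_mem_upC (by omega)) hx hy)
  have hmem : φ (M.e s) ∈ iSup p := by
    obtain ⟨a, ha, b, hb, hab⟩ := exists_nonpos_add_pos (G := G) D (fun i => by
      rw [hroot]
      rcases htri i with hi | hi | ⟨n, -, hn⟩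
      · rw [show resRoot G M φ hle i = 0 from hi]; exact ⟨0, le_rfl, by simp⟩
      · rw [show resRoot G M φ hle i = M.root s from hi, hd, if_pos rfl]
        exact ⟨1, by omega, by simp⟩
      · exact ⟨n, by omega, hn⟩) (φ (M.e s))
    obtain ⟨c, hc, r, hr, rfl⟩ := Submodule.mem_sup.1 (hle3 hb)
    obtain ⟨q, hq, y, hy, rfl⟩ := Submodule.mem_sup.1 hc
    have hzero : φ (M.e s) - y = 0 := by
      refine eq_zero_of_mem_grd (d := (D : g)) (s := {1}) (t := dnC ∪ upC 2) ?_
        (Submodule.sub_mem _ (hV (map_mem_grV fun v => M.lie_e v s)) (hP hy)) ?_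
      · rw [Set.disjoint_singleton_left]
        rintro (⟨k, hk⟩ | ⟨k, hk2, hk⟩)
        · have : ((1 + k : ℕ) : ℂ) = 0 := by push_cast; linear_combination hk
          have := Nat.cast_eq_zero.1 this
          omega
        · have : 1 = k := by exact_mod_cast hk
          omega
      · rw [hab, show a + (q + y + r) - y = a + q + r by abel]
        refine Submodule.add_mem _ (Submodule.add_mem _ ?_ ?_) ?_
        · exact grd_mono _ Set.subset_union_left ha
        · refine grd_mono _ ?_ (hP₀ hq)
          rintro _ rfl
          exact Or.inl ⟨0, by simp⟩
        · exact grd_mono _ Set.subset_union_right hr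
    rw [sub_eq_zero.1 hzero]
    exact hy
  obtain ⟨E, hE, hsum⟩ := (Submodule.mem_iSup_iff_exists_finsupp _ _).1 hmem
  refine ⟨E, fun k hk => ?_, fun k hk => ?_, ?_⟩
  · have := hE k
    rwa [hp' hk, Submodule.mem_bot] at this
  · have := hE k
    rwa [hp hk] at this
  · rw [← hsum, Finsupp.sum_fintype _ _ fun _ => rfl]

theorem exists_map_f_eq_sum (hA : IsGCM A) {hle : M.H.map φ.toLinearMap ≤ G.H}
    (hρ : ResNonneg G M φ hle) (s : S) :
    ∃ F : I → g, (∀ k ∉ GammaOf G M φ hle s, F k = 0) ∧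
      (∀ k ∈ GammaOf G M φ hle s, F k ∈ grV M φ (-M.root s) ∧
        F k ∈ gS G (cmpnt A (Jof G M φ hle ∪ {k}) k)) ∧ φ (M.f s) = ∑ k, F k := by
  have := exists_map_e_eq_sum hA hρ.flip s
  simp only [GammaOf_flip, Jof_flip, gS_flip] at this
  exact this

theorem mem_cartan_of_lie_eq_zero {T : Set I} {d : G.H} (hd : ∀ i ∈ T, G.root i d = 1) {x : g}
    (hx : x ∈ gS G T) (h : ⁅(d : g), x⁆ = 0) :
    x ∈ (Submodule.span ℂ (G.coroot '' T)).map G.H.subtype := by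
  obtain ⟨a, ha, c, hc, b, hb, rfl⟩ := exists_triangular_gS hx
  have hcH : c ∈ G.H := Submodule.map_subtype_le _ _ hc
  have hb' : b ∈ grd (d : g) (upC 1) :=
    nP_le_grd d (add_mem_upC (by omega)) (fun i hi => ⟨1, le_rfl, by rw [hd i hi]; simp⟩) hb
  have ha' : a ∈ grd (d : g) {z | -z ∈ upC 1} := by
    refine nP_le_grd (G := flipKM G) d (fun z hz w hw => ?_) (fun i hi => ?_) ha
    · rw [Set.mem_ofPred_eq, neg_add]
      exact add_mem_upC (by omega) _ hz _ hw
    · change - -G.root i d ∈ upC 1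
      exact ⟨1, le_rfl, by rw [neg_neg, hd i hi]; simp⟩
  have hzero : a + b = 0 := by
    refine eq_zero_of_mem_grd (d := (d : g)) (s := {0}) (t := {z | -z ∈ upC 1} ∪ upC 1) ?_ ?_
      (Submodule.add_mem _ (grd_mono _ Set.subset_union_left ha')
        (grd_mono _ Set.subset_union_right hb'))
    · rw [Set.disjoint_singleton_left]
      have h0 : (0 : ℂ) ∉ upC 1 := by
        rintro ⟨n, hn, h⟩
        have := Nat.cast_eq_zero.1 h.symm
        omega
      rintro (h | h)
      · exact h0 (by simpa using h)
      · exact h0 h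
    · rw [show a + b = a + c + b - c by abel]
      exact Submodule.sub_mem _ (mem_grd rfl (by rw [h, zero_smul])) (cartan_le_grd d hcH)
  rwa [show a + c + b = c + (a + b) by abel, hzero, add_zero]

theorem cAdmissibleComponent_of_mem_GammaOf (hA : IsGCM A) (hB : IsGCM B)
    (hgr : IsFinGrading M φ) {hle : M.H.map φ.toLinearMap ≤ G.H} (hρ : ResNonneg G M φ hle)
    {s : S} {k : I} (hk : k ∈ GammaOf G M φ hle s) :
    CAdmissibleComponent G (Jof G M φ hle) k := by
  obtain ⟨E, hE₀, hE, hEsum⟩ := exists_map_e_eq_sum hA hρ s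
  obtain ⟨F, hF₀, hF, hFsum⟩ := exists_map_f_eq_sum hA hρ s
  set h₀ := cartanIncl G M φ hle (M.coroot s)
  have hcomm {l l' : I} (hl : l ∈ GammaOf G M φ hle s) (hl' : l' ∈ GammaOf G M φ hle s)
      (hne : l ≠ l') {x y : g} (hx : x ∈ gS G (cmpnt A (Jof G M φ hle ∪ {l}) l))
      (hy : y ∈ gS G (cmpnt A (Jof G M φ hle ∪ {l'}) l')) : ⁅x, y⁆ = 0 :=
    lie_gS_gS_eq_zero
      (fun i hi j hj => ne_and_eq_zero_of_mem_cmpnt hA hgr hl hl' hne hi hj) hx hy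
  have hh₀sum : (h₀ : g) = ∑ l, ⁅E l, F l⁆ := by
    have h1 : (h₀ : g) = ⁅φ (M.e s), φ (M.f s)⁆ := by
      rw [← LieHom.map_lie, lie_e_f_self]
      rfl
    rw [h1, hEsum, hFsum, sum_lie]
    refine Finset.sum_congr rfl fun l _ => ?_
    rw [lie_sum]
    refine Finset.sum_eq_single_of_mem l (Finset.mem_univ l) fun l' _ hne => ?_
    by_cases hl : l ∈ GammaOf G M φ hle s
    · by_cases hl' : l' ∈ GammaOf G M φ hle s
      · exact hcomm hl hl' hne.symm (hE l hl).2 (hF l' hl').2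
      · rw [hF₀ l' hl', lie_zero]
    · rw [hE₀ l hl, zero_lie]
  have hZmem {l : I} (hl : l ∈ GammaOf G M φ hle s) :
      ⁅E l, F l⁆ ∈ gS G (cmpnt A (Jof G M φ hle ∪ {l}) l) :=
    (gS G _).lie_mem (hE l hl).2 (hF l hl).2
  have hZ {x : g} (hx : x ∈ gS G (cmpnt A (Jof G M φ hle ∪ {k}) k)) :
      ⁅⁅E k, F k⁆, x⁆ = ⁅(h₀ : g), x⁆ := by
    rw [hh₀sum, sum_lie]
    symm
    refine Finset.sum_eq_single_of_mem k (Finset.mem_univ k) fun l _ hne => ?_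
    by_cases hl : l ∈ GammaOf G M φ hle s
    · exact hcomm hl hk hne (hZmem hl) hx
    · rw [hE₀ l hl, zero_lie, zero_lie]
  obtain ⟨d, hd⟩ := exists_root_eq (G := G) fun i =>
    if i ∈ cmpnt A (Jof G M φ hle ∪ {k}) k then 1 else 0
  have hdZ : ⁅(d : g), ⁅E k, F k⁆⁆ = 0 := by
    have h1 : ⁅(d : g), (h₀ : g)⁆ = 0 := G.abelian d h₀
    rw [hh₀sum, lie_sum] at h1
    rwa [Finset.sum_eq_single_of_mem k (Finset.mem_univ k) fun l _ hne => ?_] at h1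
    by_cases hl : l ∈ GammaOf G M φ hle s
    · refine lie_gS_eq_zero_of_root (fun i hi => ?_) (hZmem hl)
      rw [hd, if_neg fun h => (ne_and_eq_zero_of_mem_cmpnt hA hgr hl hk hne hi h).1 rfl]
    · rw [hE₀ l hl, zero_lie, lie_zero]
  obtain ⟨H, hH, hHZ⟩ := mem_cartan_of_lie_eq_zero
    (fun i hi => by rw [hd, if_pos hi]) (hZmem hk) hdZ
  change (H : g) = _ at hHZ
  have hroot {i : I} (hi : i ∈ cmpnt A (Jof G M φ hle ∪ {k}) k) :
      G.root i H = resRoot G M φ hle i (M.coroot s) := by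
    have h1 := hZ (e_mem_gS hi)
    rw [← hHZ, G.lie_e, G.lie_e] at h1
    exact smul_left_injective ℂ (e_ne_zero i) h1
  have hγ : M.root s (M.coroot s) = 2 := by
    rw [M.pairing, hB.1]
    norm_num
  have hHk : G.root k H = 2 := by
    rw [hroot (self_mem_cmpnt (Or.inr rfl)), show resRoot G M φ hle k = M.root s from hk, hγ]
  have hHJ (i : I) (hi : i ∈ cmpnt A (Jof G M φ hle ∪ {k}) k) (hik : i ≠ k) :
      G.root i H = 0 := by
    rw [hroot hi, show resRoot G M φ hle i = 0 from mem_Jof_of_mem_cmpnt hi hik]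
    rfl
  refine ⟨isFiniteType_cmpnt hA hB hgr hk, H, ⟨hH, fun i hi => ?_⟩, E k, F k, (hE k hk).2,
    (hF k hk).2, ⟨fun h => ?_, hHZ.symm, ?_, ?_⟩, fun x hx => ?_⟩
  · split_ifs with hik
    · rw [hik, hHk]
    · exact hHJ i hi hik
  · rw [ZeroMemClass.coe_eq_zero.1 h, map_zero] at hHk
    exact two_ne_zero hHk.symm
  · rw [hHZ, hZ (hE k hk).2]
    have h1 := (hE k hk).1 (M.coroot s)
    rw [hγ] at h1
    rw [ofNat_smul_eq_nsmul] at h1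
    exact h1
  · rw [hHZ, hZ (hF k hk).2]
    have h1 := (hF k hk).1 (M.coroot s)
    rw [LinearMap.neg_apply, hγ, neg_smul, ofNat_smul_eq_nsmul] at h1
    exact h1
  · exact (sup_le_sup (sup_le_sup inf_le_right inf_le_right) inf_le_right :
      (_ : Submodule ℂ g) ≤ _) (gS_cmpnt_three_grading hgr hk
        (fun i hi hik => mem_Jof_of_mem_cmpnt hi hik) hHk hHJ hx)

theorem map_mem_gS_IreOf (hA : IsGCM A) {hle : M.H.map φ.toLinearMap ≤ G.H}
    (hρ : ResNonneg G M φ hle) {x : m} (hx : x ∈ gS M Set.univ) :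
    φ x ∈ gS G (IreOf G M φ hle) := by
  have hIre {s : S} {k : I} (hk : k ∈ GammaOf G M φ hle s) :
      cmpnt A (Jof G M φ hle ∪ {k}) k ⊆ IreOf G M φ hle := fun i hi => ⟨k, ⟨s, hk⟩, hi⟩
  suffices h : gS M Set.univ ≤ (gS G (IreOf G M φ hle)).comap φ from h hx
  refine LieSubalgebra.lieSpan_le.2 ?_
  rintro _ (⟨s, -, rfl⟩ | ⟨s, -, rfl⟩)
  · obtain ⟨E, hE₀, hE, hsum⟩ := exists_map_e_eq_sum hA hρ s
    change φ (M.e s) ∈ (gS G (IreOf G M φ hle)).toSubmodule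
    rw [hsum]
    refine Submodule.sum_mem _ fun k _ => ?_
    by_cases hk : k ∈ GammaOf G M φ hle s
    · exact gS_mono (hIre hk) (hE k hk).2
    · rw [hE₀ k hk]; exact Submodule.zero_mem _
  · obtain ⟨F, hF₀, hF, hsum⟩ := exists_map_f_eq_sum hA hρ s
    change φ (M.f s) ∈ (gS G (IreOf G M φ hle)).toSubmodule
    rw [hsum]
    refine Submodule.sum_mem _ fun k _ => ?_
    by_cases hk : k ∈ GammaOf G M φ hle s
    · exact gS_mono (hIre hk) (hF k hk).2
    · rw [hF₀ k hk]; exact Submodule.zero_mem _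

end Grading

end KMG
open KMG

section Statement

attribute [local instance] Classical.propDecidable

variable {I : Type*} [Fintype I] [DecidableEq I] {A : Matrix I I ℤ}
variable {g : Type*} [LieRing g] [LieAlgebra ℂ g]
variable {S : Type*} [Fintype S] [DecidableEq S] {B : Matrix S S ℤ}
variable {m : Type*} [LieRing m] [LieAlgebra ℂ m]

theorem statement8
    (hGCM : IsGCM A) (hInd : Indecomposable A) (hSym : Symmetrizable A)
    (G : KacMoodyAlgebra A g)
    (hBgcm : IsGCM B) (hBind : Indecomposable B)
    (M : KacMoodyAlgebra B m) (φ : m →ₗ⁅ℂ⁆ g)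
    (hgr : IsFinGrading M φ) (hle : M.H.map φ.toLinearMap ≤ G.H)
    (hadapt : Adapted G M φ hle)
    (Bf : g →ₗ[ℂ] g →ₗ[ℂ] ℂ) (hBf : NormalizedInvForm G Bf) :
    (∀ k ∈ IpRe G M φ hle,
        IsFiniteType (restrictM A (cmpnt A (Jof G M φ hle ∪ {k}) k))) ∧
    (∀ s : S, ∀ k ∈ GammaOf G M φ hle s, ∀ l ∈ GammaOf G M φ hle s, k ≠ l →
        (cmpnt A (Jof G M φ hle ∪ {k}) k ∩ cmpnt A (Jof G M φ hle ∪ {l}) l = ∅ ∧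
          (∀ i ∈ cmpnt A (Jof G M φ hle ∪ {k}) k,
            ∀ j ∈ cmpnt A (Jof G M φ hle ∪ {l}) l, A i j = 0) ∧
          (∀ x ∈ gS G (cmpnt A (Jof G M φ hle ∪ {k}) k),
            ∀ y ∈ gS G (cmpnt A (Jof G M φ hle ∪ {l}) l),
              ⁅x, y⁆ = 0 ∧ Bf x y = 0))) ∧
    (∀ k ∈ IpRe G M φ hle, CAdmissibleComponent G (Jof G M φ hle) k) ∧
    (∀ x : m, x ∈ LieAlgebra.derivedSeries ℂ m 1 → φ x ∈ gS G (IreOf G M φ hle)) := by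
  have hρ := hadapt.resNonneg
  refine ⟨?_, fun s k hk l hl hkl => ?_, ?_, fun x hx => ?_⟩
  · rintro k ⟨s, hk⟩
    exact isFiniteType_cmpnt hGCM hBgcm hgr hk
  · have hdis (i : I) (hi : i ∈ cmpnt A (Jof G M φ hle ∪ {k}) k) (j : I)
        (hj : j ∈ cmpnt A (Jof G M φ hle ∪ {l}) l) : i ≠ j ∧ A i j = 0 :=
      ne_and_eq_zero_of_mem_cmpnt hGCM hgr hk hl hkl hi hj
    refine ⟨?_, fun i hi j hj => (hdis i hi j hj).2, fun x hx y hy => ⟨?_, ?_⟩⟩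
    · exact Set.eq_empty_of_forall_notMem fun i hi => (hdis i hi.1 i hi.2).1 rfl
    · exact lie_gS_gS_eq_zero hdis hx hy
    · exact form_eq_zero_of_commute hGCM hBf.1.2.1
        (fun z hz => lie_gS_gS_eq_zero hdis hz hy) hx
  · rintro k ⟨s, hk⟩
    exact cAdmissibleComponent_of_mem_GammaOf hGCM hBgcm hgr hρ hk
  · exact map_mem_gS_IreOf hGCM hρ (derivedSeries_one_le_gS hx)

end Statement
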